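/- arXiv:2404.06058 — 3 statements merged into one kernel-verified Lean document; each statement's English description precedes it below -/
import Mathlib

section
/- Let p = q = ∞ and 0 < u < v ≤ ∞, and set ℓ(k,n) = k / log(n/k + 1). Then there exist constants c, C > 0 depending only on u, v such that for all n ∈ ℕ: (i) for 1 ≤ k ≤ log(n+1), c ≤ e_k(id: ℓ_{∞,u}^n → ℓ_{∞,v}^n) ≤ C; (ii) for log(n+1) ≤ k ≤ n, c · (log(ℓ(k,n)+1))^{1/v − 1/u} ≤ e_k(id: ℓ_{∞,u}^n → ℓ_{∞,v}^n) ≤ C · (log(ℓ(k,n)+1))^{1/v − 1/u}; (iii) for k ≥ n, c · 2^{−k/n} (log(n+1))^{1/v − 1/u} ≤ e_k(id: ℓ_{∞,u}^n → ℓ_{∞,v}^n) ≤ C · 2^{−k/n} (log(n+1))^{1/v − 1/u}. -/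
open scoped ENNReal Classical
open MeasureTheory

/-- The non-increasing rearrangement of `x : ℝ^n`: for `1 ≤ i ≤ n`,
`rearr n x i` is the `i`-th largest of the absolute values of the entries of `x`,
defined via `x_i^* = inf {t ≥ 0 : #{j : |x j| > t} ≤ i - 1}`. -/
noncomputable def rearr (n : ℕ) (x : Fin n → ℝ) (i : ℕ) : ℝ :=
  sInf {t : ℝ | 0 ≤ t ∧ ((Finset.univ : Finset (Fin n)).filter (fun j => t < |x j|)).card ≤ i - 1}

/-- The Lorentz quasi-norm `‖x‖_{p,u}` on `ℝ^n` for `p, u ∈ (0,∞]`, with the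
convention `1/∞ = 0`:  `‖x‖_{p,u} = (∑_{i=1}^n i^{u/p-1} (x_i^*)^u)^{1/u}` for `u < ∞`
and `‖x‖_{p,∞} = max_{1 ≤ i ≤ n} i^{1/p} x_i^*`. -/
noncomputable def lorentzNorm (n : ℕ) (p u : ℝ≥0∞) (x : Fin n → ℝ) : ℝ :=
  if u = ⊤ then
    sSup {t : ℝ | ∃ i ∈ Finset.Icc 1 n, t = (i : ℝ) ^ (1 / p).toReal * rearr n x i}
  else
    (∑ i ∈ Finset.Icc 1 n, (i : ℝ) ^ ((u / p).toReal - 1) * rearr n x i ^ u.toReal) ^ (1 / u.toReal)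

/-- The `k`-th (dyadic) entropy number of the identity map from `(ℝ^n, NX)` to `(ℝ^n, NY)`:
`e_k = inf {ε > 0 : ∃ y_1, …, y_{2^{k-1}} with B_X ⊆ ⋃ (y_i + ε B_Y)}`. -/
noncomputable def entropyNumber (n : ℕ) (NX NY : (Fin n → ℝ) → ℝ) (k : ℕ) : ℝ :=
  sInf {ε : ℝ | 0 < ε ∧ ∃ T : Finset (Fin n → ℝ), T.card ≤ 2 ^ (k - 1) ∧
    ∀ x : Fin n → ℝ, NX x ≤ 1 → ∃ y ∈ T, NY (x - y) ≤ ε}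

/-- The operator norm of the identity map from `(ℝ^n, NX)` to `(ℝ^n, NY)`:
`‖id‖ = sup {NY x : NX x ≤ 1}`. -/
noncomputable def opNorm (n : ℕ) (NX NY : (Fin n → ℝ) → ℝ) : ℝ :=
  sSup {t : ℝ | ∃ x : Fin n → ℝ, NX x ≤ 1 ∧ t = NY x}

/-! ### Level sets and the rearrangement -/

section Rearrangement

variable {n : ℕ} {x y : Fin n → ℝ} {t : ℝ} {i : ℕ}

lemma rearr_nonneg (x : Fin n → ℝ) (i : ℕ) : 0 ≤ rearr n x i :=
  Real.sInf_nonneg fun _ ht => ht.1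

lemma rearr_le_of_card_le (ht : 0 ≤ t)
    (h : ((Finset.univ : Finset (Fin n)).filter (fun j => t < |x j|)).card ≤ i - 1) :
    rearr n x i ≤ t :=
  csInf_le ⟨0, fun _ hs => hs.1⟩ ⟨ht, h⟩

lemma exists_bound_card_le (x : Fin n → ℝ) (i : ℕ) :
    {t : ℝ | 0 ≤ t ∧
      ((Finset.univ : Finset (Fin n)).filter (fun j => t < |x j|)).card ≤ i - 1}.Nonempty := by
  refine ⟨∑ j, |x j|, Finset.sum_nonneg fun _ _ => abs_nonneg _, ?_⟩
  rw [Finset.filter_false_of_mem]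
  · simp
  · intro j _
    exact not_lt.2 (Finset.single_le_sum (f := fun j => |x j|) (fun _ _ => abs_nonneg _)
      (Finset.mem_univ j))

lemma le_rearr_of_le_card (hi : 1 ≤ i)
    (h : i ≤ ((Finset.univ : Finset (Fin n)).filter (fun j => t ≤ |x j|)).card) :
    t ≤ rearr n x i := by
  refine le_csInf (exists_bound_card_le x i) fun s hs => ?_
  by_contra! hst
  have hsub : (Finset.univ : Finset (Fin n)).filter (fun j => t ≤ |x j|) ⊆
      (Finset.univ : Finset (Fin n)).filter (fun j => s < |x j|) :=
    Finset.monotone_filter_right _ fun j _ hj => hst.trans_le hj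
  have h1 := Finset.card_le_card hsub
  have h2 := hs.2
  omega

lemma rearr_mono (h : ∀ j, |x j| ≤ |y j|) (i : ℕ) : rearr n x i ≤ rearr n y i := by
  refine le_csInf (exists_bound_card_le y i) fun s hs => rearr_le_of_card_le hs.1 ?_
  exact (Finset.card_le_card
    (Finset.monotone_filter_right _ fun j _ hj => lt_of_lt_of_le hj (h j))).trans hs.2

end Rearrangement

/-! ### Harmonic sums -/

/-- The harmonic sum `∑_{i=1}^m 1/i` as a real number. -/
noncomputable def harmonicSum (m : ℕ) : ℝ := ∑ i ∈ Finset.Icc 1 m, (i : ℝ)⁻¹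

lemma harmonicSum_eq (m : ℕ) : harmonicSum m = (harmonic m : ℝ) := by
  rw [harmonicSum, harmonic_eq_sum_Icc]
  push_cast
  rfl

lemma log_add_one_le_harmonicSum (m : ℕ) : Real.log ((m : ℝ) + 1) ≤ harmonicSum m := by
  rw [harmonicSum_eq]
  exact_mod_cast log_add_one_le_harmonic m

lemma harmonicSum_le_one_add_log (m : ℕ) : harmonicSum m ≤ 1 + Real.log m := by
  rw [harmonicSum_eq]
  exact harmonic_le_one_add_log m

lemma harmonicSum_nonneg (m : ℕ) : 0 ≤ harmonicSum m :=
  Finset.sum_nonneg fun _ _ => by positivity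

lemma one_le_harmonicSum {m : ℕ} (hm : 1 ≤ m) : 1 ≤ harmonicSum m := by
  have := Finset.single_le_sum (f := fun i : ℕ => (i : ℝ)⁻¹) (s := Finset.Icc 1 m)
    (fun _ _ => by positivity) (Finset.mem_Icc.2 ⟨le_refl 1, hm⟩)
  simpa [harmonicSum] using this

lemma half_le_log_add_one {m : ℕ} (hm : 1 ≤ m) : 1 / 2 ≤ Real.log ((m : ℝ) + 1) := by
  have h1 : (1 : ℝ) ≤ m := by exact_mod_cast hm
  have := Real.log_le_log (by norm_num) (show (2 : ℝ) ≤ (m : ℝ) + 1 by linarith)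
  have := Real.log_two_gt_d9
  linarith

lemma harmonicSum_le_three_mul_log {m : ℕ} (hm : 1 ≤ m) :
    harmonicSum m ≤ 3 * Real.log ((m : ℝ) + 1) := by
  have h1 : (1 : ℝ) ≤ m := by exact_mod_cast hm
  have h2 := harmonicSum_le_one_add_log m
  have h3 := half_le_log_add_one hm
  have h4 := Real.log_le_log (by linarith) (show (m : ℝ) ≤ (m : ℝ) + 1 by linarith)
  linarith

/-! ### Lorentz norms with first index `∞` -/

section LorentzNorm

variable {n : ℕ} {u v : ℝ≥0∞}

lemma lorentzNorm_top_of_ne_top (hv : v ≠ ⊤) (x : Fin n → ℝ) :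
    lorentzNorm n ⊤ v x =
      (∑ i ∈ Finset.Icc 1 n, (i : ℝ)⁻¹ * rearr n x i ^ v.toReal) ^ (1 / v.toReal) := by
  simp [lorentzNorm, hv, Real.rpow_neg_one]

lemma lorentzNorm_top_top_le {x : Fin n → ℝ} {t : ℝ} (ht : 0 ≤ t) (h : ∀ j, |x j| ≤ t) :
    lorentzNorm n ⊤ ⊤ x ≤ t := by
  rw [lorentzNorm, if_pos rfl]
  refine Real.sSup_le ?_ ht
  rintro _ ⟨i, -, rfl⟩
  simp only [ENNReal.div_top, ENNReal.toReal_zero, Real.rpow_zero, one_mul]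
  refine rearr_le_of_card_le ht ?_
  rw [Finset.filter_false_of_mem fun j _ => not_lt.2 (h j)]
  simp

lemma toReal_one_div (v : ℝ≥0∞) : (1 / v).toReal = 1 / v.toReal := by
  simp

lemma mul_harmonicSum_rpow_le_lorentzNorm (hv : v ≠ 0) {x : Fin n → ℝ} {t : ℝ} {m : ℕ}
    (ht : 0 ≤ t) (hm : 1 ≤ m)
    (h : m ≤ ((Finset.univ : Finset (Fin n)).filter (fun j => t ≤ |x j|)).card) :
    t * harmonicSum m ^ (1 / v).toReal ≤ lorentzNorm n ⊤ v x := by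
  have hmn : m ≤ n := h.trans ((Finset.card_le_univ _).trans (by simp))
  by_cases hv' : v = ⊤
  · subst hv'
    simp only [ENNReal.div_top, ENNReal.toReal_zero, Real.rpow_zero, mul_one]
    rw [lorentzNorm, if_pos rfl]
    refine (le_rearr_of_le_card le_rfl (hm.trans h)).trans (le_csSup ?_ ?_)
    · refine ((Finset.Icc 1 n).image
        (fun i : ℕ => (i : ℝ) ^ (1 / (⊤ : ℝ≥0∞)).toReal * rearr n x i)).bddAbove.mono ?_
      rintro _ ⟨i, hi, rfl⟩
      exact Finset.mem_coe.2 (Finset.mem_image_of_mem _ hi)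
    · exact ⟨1, Finset.mem_Icc.2 ⟨le_rfl, hm.trans hmn⟩, by simp⟩
  · have hb : 0 < v.toReal := ENNReal.toReal_pos hv hv'
    rw [lorentzNorm_top_of_ne_top hv', toReal_one_div]
    have h1 : harmonicSum m * t ^ v.toReal ≤
        ∑ i ∈ Finset.Icc 1 n, (i : ℝ)⁻¹ * rearr n x i ^ v.toReal := by
      rw [harmonicSum, Finset.sum_mul]
      refine (Finset.sum_le_sum fun i hi => ?_).trans
        (Finset.sum_le_sum_of_subset_of_nonneg (Finset.Icc_subset_Icc_right hmn) fun i _ _ => ?_)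
      · rw [Finset.mem_Icc] at hi
        have := le_rearr_of_le_card hi.1 (hi.2.trans h)
        gcongr
      · have := rearr_nonneg x i
        positivity
    calc t * harmonicSum m ^ (1 / v.toReal)
        = (harmonicSum m * t ^ v.toReal) ^ (1 / v.toReal) := by
          rw [Real.mul_rpow (harmonicSum_nonneg m) (by positivity), ← Real.rpow_mul ht,
            mul_one_div_cancel hb.ne', Real.rpow_one, mul_comm]
      _ ≤ _ := by
          have := harmonicSum_nonneg m
          gcongr

lemma lorentzNorm_le_mul_harmonicSum_rpow (hv : v ≠ 0) {x : Fin n → ℝ} {t : ℝ} {m : ℕ}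
    (ht : 0 ≤ t) (h : ∀ j, |x j| ≤ t)
    (hm : ((Finset.univ : Finset (Fin n)).filter (fun j => 0 < |x j|)).card ≤ m) :
    lorentzNorm n ⊤ v x ≤ t * harmonicSum m ^ (1 / v).toReal := by
  by_cases hv' : v = ⊤
  · subst hv'
    simpa using lorentzNorm_top_top_le ht h
  · have hb : 0 < v.toReal := ENNReal.toReal_pos hv hv'
    rw [lorentzNorm_top_of_ne_top hv', toReal_one_div]
    have h1 : ∑ i ∈ Finset.Icc 1 n, (i : ℝ)⁻¹ * rearr n x i ^ v.toReal ≤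
        harmonicSum m * t ^ v.toReal := by
      rw [harmonicSum, Finset.sum_mul]
      calc _ ≤ ∑ i ∈ Finset.Icc 1 n, if i ≤ m then (i : ℝ)⁻¹ * t ^ v.toReal else 0 := by
            refine Finset.sum_le_sum fun i _ => ?_
            have h2 := rearr_nonneg x i
            split_ifs with him
            · have h3 : rearr n x i ≤ t := by
                refine rearr_le_of_card_le ht ?_
                rw [Finset.filter_false_of_mem fun j _ => not_lt.2 (h j)]
                simp
              gcongr
            · rw [le_antisymm (rearr_le_of_card_le le_rfl (by omega)) h2,
                Real.zero_rpow hb.ne', mul_zero]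
        _ ≤ ∑ i ∈ Finset.Icc 1 m, (i : ℝ)⁻¹ * t ^ v.toReal := by
            rw [← Finset.sum_filter]
            refine Finset.sum_le_sum_of_subset_of_nonneg (fun i hi => ?_)
              fun i _ _ => by positivity
            simp only [Finset.mem_filter, Finset.mem_Icc] at hi ⊢
            exact ⟨hi.1.1, hi.2⟩
    calc _ ≤ (harmonicSum m * t ^ v.toReal) ^ (1 / v.toReal) := by
          have : ∀ i, 0 ≤ rearr n x i := rearr_nonneg x
          refine Real.rpow_le_rpow (Finset.sum_nonneg fun i _ => ?_) h1 (by positivity)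
          have := this i
          positivity
      _ = t * harmonicSum m ^ (1 / v.toReal) := by
          rw [Real.mul_rpow (harmonicSum_nonneg m) (by positivity), ← Real.rpow_mul ht,
            mul_one_div_cancel hb.ne', Real.rpow_one, mul_comm]

lemma abs_le_lorentzNorm (hv : v ≠ 0) (x : Fin n → ℝ) (j : Fin n) :
    |x j| ≤ lorentzNorm n ⊤ v x := by
  have := mul_harmonicSum_rpow_le_lorentzNorm (x := x) (t := |x j|) hv (abs_nonneg _) le_rfl
    (Finset.card_pos.2 ⟨j, by simp⟩)
  simpa [harmonicSum] using this

lemma lorentzNorm_le_rpow_of_abs_le (hu : u ≠ 0) (huv : u < v) {x z : Fin n → ℝ} {δ : ℝ}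
    (hx : lorentzNorm n ⊤ u x ≤ 1) (hδ : 0 < δ) (hzδ : ∀ j, |z j| ≤ δ)
    (hzx : ∀ j, |z j| ≤ |x j|) :
    lorentzNorm n ⊤ v z ≤ δ ^ (1 - u.toReal * (1 / v).toReal) := by
  have hu' : u ≠ ⊤ := huv.ne_top
  have ha : 0 < u.toReal := ENNReal.toReal_pos hu hu'
  by_cases hv' : v = ⊤
  · subst hv'
    simpa using lorentzNorm_top_top_le hδ.le hzδ
  · have hab : u.toReal < v.toReal := (ENNReal.toReal_lt_toReal hu' hv').2 huv
    have hb : 0 < v.toReal := ha.trans hab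
    have hz : ∀ i, 0 ≤ rearr n z i := rearr_nonneg z
    rw [lorentzNorm_top_of_ne_top hu'] at hx
    rw [lorentzNorm_top_of_ne_top hv', toReal_one_div]
    have hsum : ∑ i ∈ Finset.Icc 1 n, (i : ℝ)⁻¹ * rearr n x i ^ u.toReal ≤ 1 := by
      by_contra! hlt
      exact absurd hx (not_le.2 (Real.one_lt_rpow hlt (by positivity)))
    have h1 : ∑ i ∈ Finset.Icc 1 n, (i : ℝ)⁻¹ * rearr n z i ^ v.toReal ≤
        δ ^ (v.toReal - u.toReal) := by
      calc _ ≤ ∑ i ∈ Finset.Icc 1 n,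
            δ ^ (v.toReal - u.toReal) * ((i : ℝ)⁻¹ * rearr n x i ^ u.toReal) := by
            refine Finset.sum_le_sum fun i _ => ?_
            have h2 : rearr n z i ≤ δ := by
              refine rearr_le_of_card_le hδ.le ?_
              rw [Finset.filter_false_of_mem fun j _ => not_lt.2 (hzδ j)]
              simp
            have h3 := rearr_mono hzx i
            have h4 : rearr n z i ^ v.toReal =
                rearr n z i ^ (v.toReal - u.toReal) * rearr n z i ^ u.toReal := by
              rw [← Real.rpow_add_of_nonneg (hz i) (by linarith) ha.le]
              ring_nf
            have h5 := hz i
            have h6 : rearr n z i ^ (v.toReal - u.toReal) ≤ δ ^ (v.toReal - u.toReal) :=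
              Real.rpow_le_rpow h5 h2 (by linarith)
            rw [h4, mul_left_comm]
            gcongr
        _ ≤ δ ^ (v.toReal - u.toReal) := by
            rw [← Finset.mul_sum]
            exact mul_le_of_le_one_right (by positivity) hsum
    calc _ ≤ (δ ^ (v.toReal - u.toReal)) ^ (1 / v.toReal) := by
          refine Real.rpow_le_rpow (Finset.sum_nonneg fun i _ => ?_) h1 (by positivity)
          have := hz i
          positivity
      _ = _ := by
          rw [← Real.rpow_mul hδ.le]
          congr 1
          field_simp

lemma lorentzNorm_le_one_of_lt (hu : u ≠ 0) (huv : u < v) {x : Fin n → ℝ}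
    (hx : lorentzNorm n ⊤ u x ≤ 1) : lorentzNorm n ⊤ v x ≤ 1 := by
  simpa using lorentzNorm_le_rpow_of_abs_le hu huv hx one_pos
    (fun j => (abs_le_lorentzNorm hu x j).trans hx) (fun _ => le_rfl)

end LorentzNorm

/-! ### Covers and entropy numbers -/

/-- `HasCover n NX NY k ε`: the unit ball of `NX` is covered by at most `2^(k-1)` balls of `NY`
of radius `ε`. -/
def HasCover (n : ℕ) (NX NY : (Fin n → ℝ) → ℝ) (k : ℕ) (ε : ℝ) : Prop :=
  ∃ T : Finset (Fin n → ℝ), T.card ≤ 2 ^ (k - 1) ∧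
    ∀ x : Fin n → ℝ, NX x ≤ 1 → ∃ y ∈ T, NY (x - y) ≤ ε

section Entropy

variable {n k : ℕ} {NX NY : (Fin n → ℝ) → ℝ} {ε : ℝ}

lemma HasCover.mono {k' : ℕ} (h : HasCover n NX NY k ε) (hk : k ≤ k') :
    HasCover n NX NY k' ε := by
  obtain ⟨T, hT, h⟩ := h
  exact ⟨T, hT.trans (Nat.pow_le_pow_right two_pos (by omega)), h⟩

lemma entropyNumber_le (hε : 0 < ε) (h : HasCover n NX NY k ε) : entropyNumber n NX NY k ≤ ε :=
  csInf_le ⟨0, fun _ hs => hs.1.le⟩ ⟨hε, h⟩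

lemma hasCover_one_of_lt {u v : ℝ≥0∞} (hu : u ≠ 0) (huv : u < v) :
    HasCover n (lorentzNorm n ⊤ u) (lorentzNorm n ⊤ v) k 1 :=
  ⟨{0}, by simpa using Nat.one_le_two_pow, fun x hx =>
    ⟨0, by simp, by simpa using lorentzNorm_le_one_of_lt hu huv hx⟩⟩

lemma le_entropyNumber {u v : ℝ≥0∞} (hu : u ≠ 0) (huv : u < v) {c : ℝ}
    (h : ∀ ε, 0 < ε → HasCover n (lorentzNorm n ⊤ u) (lorentzNorm n ⊤ v) k ε → c ≤ ε) :
    c ≤ entropyNumber n (lorentzNorm n ⊤ u) (lorentzNorm n ⊤ v) k :=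
  le_csInf ⟨1, one_pos, hasCover_one_of_lt hu huv⟩ fun ε hε => h ε hε.1 hε.2

end Entropy

lemma rpow_le_mul_rpow_of_le_mul {E x y K : ℝ} (hE : E ≤ 0) (hx : 0 < x) (hK : 0 < K)
    (h : x ≤ K * y) : y ^ E ≤ K ^ (-E) * x ^ E := by
  have h1 : x / K ≤ y := by rwa [div_le_iff₀' hK]
  refine (Real.rpow_le_rpow_of_nonpos (by positivity) h1 hE).trans ?_
  rw [Real.div_rpow hx.le hK.le, Real.rpow_neg hK.le, div_eq_inv_mul]

/-! ### Counting lemmas -/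

lemma card_mul_le_pow {ι α : Type*} [Fintype ι] [DecidableEq ι] (F : Finset α)
    (W : Finset (ι → α)) (g : ι → α → ℝ) (η G : ℝ) (hg : ∀ i a, 0 ≤ g i a)
    (hWF : ∀ w ∈ W, ∀ i, w i ∈ F) (hW : ∀ w ∈ W, η ≤ ∏ i, g i (w i))
    (hG : ∀ i, ∑ a ∈ F, g i a ≤ G) :
    W.card * η ≤ G ^ Fintype.card ι := by
  calc (W.card : ℝ) * η ≤ ∑ w ∈ W, ∏ i, g i (w i) := by
        rw [← nsmul_eq_mul]
        exact Finset.card_nsmul_le_sum _ _ _ hW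
    _ ≤ ∑ w ∈ Fintype.piFinset fun _ : ι => F, ∏ i, g i (w i) :=
        Finset.sum_le_sum_of_subset_of_nonneg
          (fun w hw => Fintype.mem_piFinset.2 (hWF w hw))
          fun w _ _ => Finset.prod_nonneg fun i _ => hg i _
    _ = ∏ i, ∑ a ∈ F, g i a := (Finset.prod_univ_sum _ _).symm
    _ ≤ ∏ _i : ι, G := Finset.prod_le_prod
        (fun i _ => Finset.sum_nonneg fun a _ => hg i a) fun i _ => hG i
    _ = G ^ Fintype.card ι := by simp

lemma sum_Icc_inv_one_add_div_sq_le {B : ℝ} (hB : 0 < B) (R : ℕ) :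
    ∑ a ∈ Finset.Icc 1 R, ((1 + (a : ℝ) / B) ^ 2)⁻¹ ≤ B := by
  have key : ∑ a ∈ Finset.Icc 1 R, ((1 + (a : ℝ) / B) ^ 2)⁻¹ ≤ B - B ^ 2 / (B + R) := by
    induction R with
    | zero => simp [sq, hB.ne']
    | succ R ih =>
      rw [Finset.sum_Icc_succ_top (by omega)]
      have hR : (0 : ℝ) ≤ R := Nat.cast_nonneg R
      have h1 : ((1 + ((R + 1 : ℕ) : ℝ) / B) ^ 2)⁻¹ ≤
          B ^ 2 / (B + R) - B ^ 2 / (B + ((R + 1 : ℕ) : ℝ)) := by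
        push_cast
        have h2 : ((1 + ((R : ℝ) + 1) / B) ^ 2)⁻¹ = B ^ 2 / (B + (R + 1)) ^ 2 := by
          field_simp
        rw [h2, div_sub_div _ _ (by positivity) (by positivity),
          div_le_div_iff₀ (by positivity) (by positivity)]
        have : 0 ≤ B ^ 2 * (B + (R + 1)) * B ^ 0 := by positivity
        nlinarith [mul_nonneg this hB.le]
      linarith
  have : 0 ≤ B ^ 2 / (B + R) := by positivity
  linarith

lemma sum_Icc_int_le (f : ℕ → ℝ) (R : ℕ) :
    ∑ a ∈ Finset.Icc (-(R : ℤ)) R, f a.natAbs = f 0 + 2 * ∑ a ∈ Finset.Icc 1 R, f a := by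
  induction R with
  | zero => simp
  | succ R ih =>
    have h : Finset.Icc (-((R + 1 : ℕ) : ℤ)) ((R + 1 : ℕ) : ℤ) =
        insert (-((R + 1 : ℕ) : ℤ)) (insert ((R + 1 : ℕ) : ℤ) (Finset.Icc (-(R : ℤ)) R)) := by
      ext a
      simp only [Finset.mem_Icc, Finset.mem_insert]
      omega
    rw [h, Finset.sum_insert, Finset.sum_insert, ih, Finset.sum_Icc_succ_top (by omega)]
    · rw [Int.natAbs_neg, Int.natAbs_natCast]
      ring
    · simp
    · simp only [Finset.mem_insert, Finset.mem_Icc]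
      omega

lemma exists_int_toward_zero (y : ℝ) :
    ∃ w : ℤ, |(w : ℝ)| ≤ |y| ∧ |y - w| ≤ 1 ∧ |y - w| ≤ |y| := by
  rcases le_total 0 y with hy | hy
  · refine ⟨⌊y⌋, ?_⟩
    have h0 : (0 : ℝ) ≤ ⌊y⌋ := by exact_mod_cast Int.floor_nonneg.2 hy
    have h1 := Int.floor_le y
    have h2 := Int.lt_floor_add_one y
    rw [abs_of_nonneg h0, abs_of_nonneg hy, abs_of_nonneg (by linarith)]
    exact ⟨h1, by linarith, by linarith⟩
  · refine ⟨⌈y⌉, ?_⟩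
    have h0 : (⌈y⌉ : ℝ) ≤ 0 := by exact_mod_cast Int.ceil_le.2 (by exact_mod_cast hy)
    have h1 := Int.le_ceil y
    have h2 := Int.ceil_lt_add_one y
    rw [abs_of_nonpos h0, abs_of_nonpos hy, abs_of_nonpos (by linarith)]
    exact ⟨by linarith, by linarith, by linarith⟩

/-! ### Logarithmic size of points of the unit ball -/

section LogSize

variable {n : ℕ} {u : ℝ≥0∞}

lemma card_level_le_exp (hu : u ≠ 0) (hu' : u ≠ ⊤) {x : Fin n → ℝ}
    (hx : lorentzNorm n ⊤ u x ≤ 1) {D : ℝ} (hD : 0 < D) :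
    (((Finset.univ : Finset (Fin n)).filter
      (fun j => D ^ (-(1 / u.toReal)) ≤ |x j|)).card : ℝ) ≤ Real.exp D := by
  have ha : 0 < u.toReal := ENNReal.toReal_pos hu hu'
  set s := ((Finset.univ : Finset (Fin n)).filter
    (fun j => D ^ (-(1 / u.toReal)) ≤ |x j|)).card with hs
  rcases Nat.eq_zero_or_pos s with h0 | h0
  · rw [h0]
    simpa using (Real.exp_pos D).le
  · have h1 := (mul_harmonicSum_rpow_le_lorentzNorm hu (by positivity) h0 hs.le).trans hx
    have hH := harmonicSum_nonneg s
    rw [toReal_one_div, Real.rpow_neg hD.le, ← div_eq_inv_mul, div_le_one (by positivity),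
      Real.rpow_le_rpow_iff hH hD.le (by positivity)] at h1
    have h2 := (log_add_one_le_harmonicSum s).trans h1
    rw [Real.log_le_iff_le_exp (by positivity)] at h2
    linarith

/-- The constant in the logarithmic size estimate. -/
noncomputable def logSizeConst (a : ℝ) : ℝ := Real.log (1 + 2 ^ (1 / a)) + 1 + 2 * (1 / a)

lemma logSizeConst_pos {a : ℝ} (ha : 0 < a) : 0 < logSizeConst a := by
  have : 0 ≤ Real.log (1 + (2 : ℝ) ^ (1 / a)) := Real.log_nonneg (by
    have : (0 : ℝ) < 2 ^ (1 / a) := by positivity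
    linarith)
  unfold logSizeConst
  positivity

lemma log_one_add_rpow_le {p D : ℝ} (hp : 0 < p) (hD : 0 < D) :
    Real.log (1 + D ^ p) ≤ (1 + 2 * p) * Real.exp (D / 2) := by
  have h1 : D ^ p ≤ Real.exp (p * D) := by
    have : D ≤ Real.exp D := by linarith [Real.add_one_le_exp D]
    calc D ^ p ≤ (Real.exp D) ^ p := by gcongr
      _ = _ := by rw [← Real.exp_mul, mul_comm]
  have h2 : 1 ≤ Real.exp (p * D) := Real.one_le_exp (by positivity)
  have h3 : Real.log (1 + D ^ p) ≤ Real.log (2 * Real.exp (p * D)) :=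
    Real.log_le_log (by positivity) (by linarith)
  rw [Real.log_mul two_ne_zero (Real.exp_pos _).ne', Real.log_exp] at h3
  have h4 := Real.log_two_lt_d9
  have h5 := Real.add_one_le_exp (D / 2)
  nlinarith

lemma sum_log_one_add_le (hu : u ≠ 0) (hu' : u ≠ ⊤) {x : Fin n → ℝ}
    (hx : lorentzNorm n ⊤ u x ≤ 1) {D : ℝ} (hD : 0 < D) :
    ∑ j ∈ (Finset.univ : Finset (Fin n)).filter (fun j => D ^ (-(1 / u.toReal)) ≤ |x j|),
      Real.log (1 + |x j| * D ^ (1 / u.toReal)) ≤ logSizeConst u.toReal * Real.exp D := by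
  have ha : 0 < u.toReal := ENNReal.toReal_pos hu hu'
  set p := 1 / u.toReal with hp
  have hp0 : 0 < p := by positivity
  have hDp : 0 < D ^ p := by positivity
  set S := (Finset.univ : Finset (Fin n)).filter (fun j => D ^ (-p) ≤ |x j|) with hS
  set S' := (Finset.univ : Finset (Fin n)).filter (fun j => (D / 2) ^ (-p) ≤ |x j|) with hS'
  have hcS : (S.card : ℝ) ≤ Real.exp D := card_level_le_exp hu hu' hx hD
  have hcS' : (S'.card : ℝ) ≤ Real.exp (D / 2) := card_level_le_exp hu hu' hx (half_pos hD)
  have hl0 : 0 ≤ Real.log (1 + (2 : ℝ) ^ p) := Real.log_nonneg (by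
    have : (0 : ℝ) < 2 ^ p := by positivity
    linarith)
  have hl1 : 0 ≤ Real.log (1 + D ^ p) := Real.log_nonneg (by linarith)
  have hterm : ∀ j ∈ S, Real.log (1 + |x j| * D ^ p) ≤
      Real.log (1 + (2 : ℝ) ^ p) + if j ∈ S' then Real.log (1 + D ^ p) else 0 := by
    intro j _
    have hxj := abs_nonneg (x j)
    by_cases hj : j ∈ S'
    · rw [if_pos hj]
      have : Real.log (1 + |x j| * D ^ p) ≤ Real.log (1 + D ^ p) := by
        refine Real.log_le_log (by positivity) ?_
        have := mul_le_of_le_one_left hDp.le ((abs_le_lorentzNorm hu x j).trans hx)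
        linarith
      linarith
    · rw [if_neg hj, add_zero]
      refine Real.log_le_log (by positivity) ?_
      have h1 : |x j| < (D / 2) ^ (-p) := by simpa [hS'] using hj
      have h2 : (D / 2) ^ (-p) * D ^ p = 2 ^ p := by
        rw [Real.rpow_neg (by positivity), Real.div_rpow hD.le two_pos.le]
        field_simp
      have := mul_le_mul_of_nonneg_right h1.le hDp.le
      linarith
  calc _ ≤ ∑ j ∈ S, (Real.log (1 + (2 : ℝ) ^ p) + if j ∈ S' then Real.log (1 + D ^ p) else 0) :=
        Finset.sum_le_sum hterm
    _ ≤ S.card * Real.log (1 + (2 : ℝ) ^ p) + S'.card * Real.log (1 + D ^ p) := by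
        rw [Finset.sum_add_distrib, Finset.sum_const, nsmul_eq_mul, ← Finset.sum_filter,
          Finset.sum_const, nsmul_eq_mul]
        gcongr
        intro j hj
        exact (Finset.mem_filter.1 hj).2
    _ ≤ Real.exp D * Real.log (1 + (2 : ℝ) ^ p) +
          Real.exp (D / 2) * ((1 + 2 * p) * Real.exp (D / 2)) := by
        have := log_one_add_rpow_le hp0 hD
        gcongr
    _ = logSizeConst u.toReal * Real.exp D := by
        have : Real.exp D = Real.exp (D / 2) * Real.exp (D / 2) := by
          rw [← Real.exp_add]; ring_nf
        rw [logSizeConst, ← hp, this]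
        ring

end LogSize

/-! ### Upper bounds -/

section Upper

variable {n k : ℕ} {u v : ℝ≥0∞}

lemma HasCover.mono_radius {NX NY : (Fin n → ℝ) → ℝ} {ε ε' : ℝ} (h : HasCover n NX NY k ε)
    (hε : ε ≤ ε') : HasCover n NX NY k ε' := by
  obtain ⟨T, hT, h⟩ := h
  refine ⟨T, hT, fun x hx => ?_⟩
  obtain ⟨y, hy, hxy⟩ := h x hx
  exact ⟨y, hy, hxy.trans hε⟩

/-- Rounding towards zero on the grid `δ ℤ^n` gives a cover whose size is controlled by a
weighted count of the grid points that occur. -/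
lemma hasCover_of_grid (hu : u ≠ 0) {δ ε η G : ℝ} (hδ : 0 < δ) (hη : 0 < η) (g : ℤ → ℝ)
    (hg : ∀ a, 0 ≤ g a) (hG : ∀ R : ℕ, ∑ a ∈ Finset.Icc (-(R : ℤ)) R, g a ≤ G)
    (hw : ∀ x : Fin n → ℝ, lorentzNorm n ⊤ u x ≤ 1 → ∀ w : Fin n → ℤ,
      (∀ j, |(w j : ℝ)| ≤ |x j| / δ) → η ≤ ∏ j, g (w j))
    (hcount : G ^ n ≤ 2 ^ (k - 1) * η)
    (hε : ∀ x z : Fin n → ℝ, lorentzNorm n ⊤ u x ≤ 1 → (∀ j, |z j| ≤ δ) →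
      (∀ j, |z j| ≤ |x j|) → lorentzNorm n ⊤ v z ≤ ε) :
    HasCover n (lorentzNorm n ⊤ u) (lorentzNorm n ⊤ v) k ε := by
  set R : ℕ := ⌈1 / δ⌉₊
  set F : Finset ℤ := Finset.Icc (-(R : ℤ)) R
  set W : Finset (Fin n → ℤ) :=
    (Fintype.piFinset fun _ => F).filter (fun w => η ≤ ∏ j, g (w j)) with hW
  refine ⟨W.image fun w j => δ * (w j : ℝ), Finset.card_image_le.trans ?_, fun x hx => ?_⟩
  · have h1 := card_mul_le_pow F W (fun _ => g) η G (fun _ => hg)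
      (fun w hw' => Fintype.mem_piFinset.1 (Finset.mem_filter.1 hw').1)
      (fun w hw' => (Finset.mem_filter.1 hw').2) (fun _ => hG R)
    rw [Fintype.card_fin] at h1
    have h2 : (W.card : ℝ) ≤ 2 ^ (k - 1) := le_of_mul_le_mul_right (h1.trans hcount) hη
    exact_mod_cast h2
  · choose w hw1 hw2 hw3 using fun j => exists_int_toward_zero (x j / δ)
    have habs : ∀ j, |x j / δ| = |x j| / δ := fun j => by rw [abs_div, abs_of_pos hδ]
    have hsub : ∀ j, |(x - fun j => δ * (w j : ℝ)) j| = δ * |x j / δ - w j| := fun j => by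
      rw [← abs_of_pos hδ, ← abs_mul, abs_of_pos hδ, mul_sub, mul_div_cancel₀ _ hδ.ne']
      rfl
    have hwx : ∀ j, |(w j : ℝ)| ≤ |x j| / δ := fun j => (hw1 j).trans (habs j).le
    refine ⟨_, Finset.mem_image_of_mem _ (Finset.mem_filter.2
      ⟨Fintype.mem_piFinset.2 fun j => ?_, hw x hx w hwx⟩), hε x _ hx (fun j => ?_) fun j => ?_⟩
    · have h1 : |(w j : ℝ)| ≤ R := by
        refine (hwx j).trans (le_trans ?_ (Nat.le_ceil _))
        have := (abs_le_lorentzNorm hu x j).trans hx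
        gcongr
      rw [abs_le] at h1
      exact Finset.mem_Icc.2 ⟨by exact_mod_cast h1.1, by exact_mod_cast h1.2⟩
    · rw [hsub]
      exact mul_le_of_le_one_right hδ.le (hw2 j)
    · rw [hsub]
      calc δ * |x j / δ - w j| ≤ δ * (|x j| / δ) := by
            rw [← habs]
            exact mul_le_mul_of_nonneg_left (hw3 j) hδ.le
        _ = |x j| := mul_div_cancel₀ _ hδ.ne'

lemma div_rpow_neg_eq {D : ℝ} (hD : 0 < D) (y p : ℝ) : y / D ^ (-p) = y * D ^ p := by
  rw [Real.rpow_neg hD.le, div_inv_eq_mul]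

lemma hasCover_sparse (hu : u ≠ 0) (huv : u < v) {M : ℝ} (hM : 1 < M) (hMn : M ≤ n)
    (hk : M * (Real.log (n / M) + 2 * logSizeConst u.toReal + 2) ≤ (k - 1 : ℕ) * Real.log 2) :
    HasCover n (lorentzNorm n ⊤ u) (lorentzNorm n ⊤ v) k
      (Real.log M ^ ((1 / v).toReal - (1 / u).toReal)) := by
  have hu' : u ≠ ⊤ := huv.ne_top
  have ha : 0 < u.toReal := ENNReal.toReal_pos hu hu'
  have hM0 : 0 < M := one_pos.trans hM
  have hn : (0 : ℝ) < n := hM0.trans_le hMn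
  set D := Real.log M with hDdef
  have hD : 0 < D := Real.log_pos hM
  have hexp : Real.exp D = M := Real.exp_log hM0
  set p := 1 / u.toReal with hp
  set L := Real.log (n / M) with hL
  have hL0 : 0 ≤ L := Real.log_nonneg ((one_le_div hM0).2 hMn)
  set K := logSizeConst u.toReal
  set δ := D ^ (-p) with hδdef
  have hδ : 0 < δ := by positivity
  set g : ℤ → ℝ := fun a => if a.natAbs = 0 then 1 else M / n * ((1 + (a.natAbs : ℝ) / 1) ^ 2)⁻¹
    with hg
  refine hasCover_of_grid (η := Real.exp (-(M * (L + 2 * K)))) (G := 1 + 2 * (M / n)) hu hδ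
    (Real.exp_pos _) g (fun a => ?_) (fun R => ?_) (fun x hx w hw => ?_) ?_ (fun x z hx h1 h2 => ?_)
  · simp only [hg]
    split_ifs <;> positivity
  · rw [sum_Icc_int_le (fun a : ℕ => if a = 0 then 1 else M / n * ((1 + (a : ℝ) / 1) ^ 2)⁻¹) R]
    have h1 : ∑ a ∈ Finset.Icc 1 R,
        (if a = 0 then 1 else M / n * ((1 + (a : ℝ) / 1) ^ 2)⁻¹) ≤ M / n := by
      rw [Finset.sum_congr rfl (g := fun a : ℕ => M / n * ((1 + (a : ℝ) / 1) ^ 2)⁻¹) fun a ha => by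
        rw [Finset.mem_Icc] at ha
        rw [if_neg (by omega)], ← Finset.mul_sum]
      exact mul_le_of_le_one_right (by positivity) (sum_Icc_inv_one_add_div_sq_le one_pos R)
    simp only [if_true]
    linarith
  · set S := (Finset.univ : Finset (Fin n)).filter (fun j => D ^ (-p) ≤ |x j|) with hS
    have hcS : (S.card : ℝ) ≤ M := (card_level_le_exp hu hu' hx hD).trans hexp.le
    have hlog := sum_log_one_add_le hu hu' hx hD
    rw [hexp] at hlog
    have hj : ∀ j, Real.exp (-(if j ∈ S then L + 2 * Real.log (1 + |x j| * D ^ p) else 0)) ≤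
        g (w j) := by
      intro j
      have hxD : 0 ≤ |x j| * D ^ p := by positivity
      have hwj : ((w j).natAbs : ℝ) ≤ |x j| * D ^ p := by
        rw [Nat.cast_natAbs, Int.cast_abs, ← div_rpow_neg_eq hD]
        exact hw j
      have hl : 0 ≤ Real.log (1 + |x j| * D ^ p) := Real.log_nonneg (by linarith)
      by_cases h0 : (w j).natAbs = 0
      · simp only [hg, h0, if_true]
        rw [Real.exp_le_one_iff]
        split_ifs <;> linarith
      · have h1 : (1 : ℝ) ≤ (w j).natAbs := by exact_mod_cast Nat.one_le_iff_ne_zero.2 h0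
        have hjS : j ∈ S := by
          have h2 : 1 ≤ |x j| / D ^ (-p) := by
            rw [div_rpow_neg_eq hD]
            exact h1.trans hwj
          rw [one_le_div hδ] at h2
          simpa [hS] using h2
        simp only [hg, h0, if_false, if_pos hjS, div_one]
        have h3 : Real.exp (-(L + 2 * Real.log (1 + |x j| * D ^ p))) =
            M / n * ((1 + |x j| * D ^ p) ^ 2)⁻¹ := by
          rw [neg_add, Real.exp_add, Real.exp_neg, Real.exp_neg, hL, Real.exp_log (by positivity),
            inv_div, two_mul, Real.exp_add, Real.exp_log (by positivity), sq]
        rw [h3]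
        gcongr
    calc Real.exp (-(M * (L + 2 * K)))
        ≤ Real.exp (∑ j, -(if j ∈ S then L + 2 * Real.log (1 + |x j| * D ^ p) else 0)) := by
          rw [Real.exp_le_exp, Finset.sum_neg_distrib, neg_le_neg_iff, ← Finset.sum_filter,
            Finset.filter_mem_eq_inter, Finset.univ_inter, Finset.sum_add_distrib,
            Finset.sum_const, nsmul_eq_mul, ← Finset.mul_sum]
          have := mul_le_mul_of_nonneg_right hcS hL0
          linarith
      _ = ∏ j, Real.exp (-(if j ∈ S then L + 2 * Real.log (1 + |x j| * D ^ p) else 0)) :=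
          Real.exp_sum _ _
      _ ≤ ∏ j, g (w j) := Finset.prod_le_prod (fun _ _ => (Real.exp_pos _).le) fun j _ => hj j
  · have h1 : (1 + 2 * (M / n)) ^ n ≤ Real.exp (2 * M) := by
      calc (1 + 2 * (M / n)) ^ n ≤ Real.exp (2 * (M / n)) ^ n := by
            gcongr
            linarith [Real.add_one_le_exp (2 * (M / n))]
        _ = Real.exp (2 * M) := by
            rw [← Real.exp_nat_mul]
            congr 1
            field_simp
    have h2 : (2 : ℝ) ^ (k - 1) = Real.exp ((k - 1 : ℕ) * Real.log 2) := by
      rw [Real.exp_nat_mul, Real.exp_log two_pos]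
    rw [h2, ← Real.exp_add]
    refine h1.trans (Real.exp_le_exp.2 ?_)
    linarith
  · refine (lorentzNorm_le_rpow_of_abs_le hu huv hx hδ h1 h2).trans (le_of_eq ?_)
    rw [hδdef, ← Real.rpow_mul hD.le, toReal_one_div u, ← hp]
    congr 1
    rw [hp]
    field_simp
    ring

lemma exponent_nonpos (hu : u ≠ 0) (huv : u < v) : (1 / v).toReal - (1 / u).toReal ≤ 0 :=
  sub_nonpos.2 (ENNReal.toReal_mono (by simp [hu]) (ENNReal.div_le_div_left huv.le 1))

lemma one_le_div_log {n k : ℕ} (hk : 0 < k) (hn : Real.log ((n : ℝ) + 1) ≤ k) (hkn : k ≤ n) :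
    1 ≤ (k : ℝ) / Real.log ((n : ℝ) / k + 1) := by
  have hk' : (1 : ℝ) ≤ k := by exact_mod_cast hk
  have hn' : (1 : ℝ) ≤ n := hk'.trans (by exact_mod_cast hkn)
  have h1 : 0 < Real.log ((n : ℝ) / k + 1) := Real.log_pos (by
    have : 0 < (n : ℝ) / k := by positivity
    linarith)
  rw [one_le_div h1]
  refine le_trans (Real.log_le_log (by positivity) ?_) hn
  have := div_le_self (by positivity : (0 : ℝ) ≤ n) hk'
  linarith

/-- The choice of the proportionality constant in the sparse cover. -/
lemma exists_sparsity_constant {K : ℝ} (hK : 0 < K) :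
    ∃ c N : ℝ, 0 < c ∧ 0 < N ∧ c ≤ 1 / 2 ∧ Real.log (1 / c) ≤ 2 * N ∧
      c * (2 + 2 * (2 * N) + 4 * K + 4) ≤ 1 / 4 := by
  have hN1 : 40 ≤ 4 * (4 * K + 10) := by linarith
  refine ⟨((4 * (4 * K + 10)) ^ 2)⁻¹, 4 * (4 * K + 10), by positivity, by positivity, ?_, ?_, ?_⟩
  · rw [one_div]
    gcongr
    nlinarith
  · rw [one_div, inv_inv, Real.log_pow]
    have := Real.log_le_sub_one_of_pos (show 0 < 4 * (4 * K + 10) by positivity)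
    push_cast
    linarith
  · rw [inv_mul_le_iff₀ (by positivity)]
    nlinarith

/-- The radius bound of the intermediate range, in terms of covers. -/
lemma exists_hasCover_mid (hu : u ≠ 0) (huv : u < v) :
    ∃ C : ℝ, 0 < C ∧ ∀ n k : ℕ, 0 < k → Real.log ((n : ℝ) + 1) ≤ k → k ≤ n →
      HasCover n (lorentzNorm n ⊤ u) (lorentzNorm n ⊤ v) k
        (C * Real.log ((k : ℝ) / Real.log ((n : ℝ) / k + 1) + 1) ^
          ((1 / v).toReal - (1 / u).toReal)) := by
  have ha : 0 < u.toReal := ENNReal.toReal_pos hu huv.ne_top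
  set E := (1 / v).toReal - (1 / u).toReal with hEdef
  have hE : E ≤ 0 := exponent_nonpos hu huv
  set K := logSizeConst u.toReal
  have hK : 0 < K := logSizeConst_pos ha
  obtain ⟨c, N, hc0, hN0, hc1, hlogc, hcN⟩ := exists_sparsity_constant hK
  set Λ := Real.log (2 / c + 1) with hΛ
  have hΛ0 : 0 < Λ := Real.log_pos (by
    have : 0 < 2 / c := by positivity
    linarith)
  set Q := 1 + Real.log (2 / c) / Real.log 2 with hQ
  have hlog2 := Real.log_two_gt_d9
  have hlog2c : 0 ≤ Real.log (2 / c) := Real.log_nonneg (by rw [le_div_iff₀ hc0]; linarith)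
  have hQ0 : 0 < Q := by positivity
  refine ⟨Λ ^ (-E) + Q ^ (-E), by positivity, fun n k hk hn hkn => ?_⟩
  have hk' : (1 : ℝ) ≤ k := by exact_mod_cast hk
  have hkn' : (k : ℝ) ≤ n := by exact_mod_cast hkn
  have hn' : (1 : ℝ) ≤ n := hk'.trans hkn'
  set t := (n : ℝ) / k with ht
  have ht1 : 1 ≤ t := (one_le_div (by positivity)).2 hkn'
  set L := Real.log (t + 1) with hL
  have hL2 : 1 / 2 ≤ L := by
    have := Real.log_le_log two_pos (show (2 : ℝ) ≤ t + 1 by linarith)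
    linarith
  set l := (k : ℝ) / L with hl
  have hl1 : 1 ≤ l := one_le_div_log hk hn hkn
  have hl0 : 0 < Real.log (l + 1) := Real.log_pos (by linarith)
  have hpos : 0 ≤ Real.log (l + 1) ^ E := by positivity
  have hposΛ : 0 ≤ Λ ^ (-E) * Real.log (l + 1) ^ E := by positivity
  have hposQ : 0 ≤ Q ^ (-E) * Real.log (l + 1) ^ E := by positivity
  rcases lt_or_ge (c * l) 2 with hM | hM
  · refine (hasCover_one_of_lt hu huv).mono_radius ?_
    have h1 : Real.log (l + 1) ≤ Λ * 1 := by
      rw [mul_one]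
      refine Real.log_le_log (by linarith) ?_
      have : l ≤ 2 / c := by rw [le_div_iff₀ hc0]; linarith
      linarith
    have := rpow_le_mul_rpow_of_le_mul hE hl0 hΛ0 h1
    rw [Real.one_rpow] at this
    linarith
  · set M := c * l with hMdef
    have hM0 : 0 < M := by linarith
    have hlk : l ≤ 2 * k := by
      rw [hl, div_le_iff₀ (by linarith)]
      nlinarith
    have hMk : M ≤ 2 * c * k := by
      linarith [mul_le_mul_of_nonneg_left hlk hc0.le]
    have hMk' : M ≤ k := hMk.trans (mul_le_of_le_one_left (by linarith) (by linarith))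
    have hk2 : (2 : ℝ) ≤ k := hM.trans hMk'
    have hMn : M ≤ n := hMk'.trans hkn'
    have hlogM : Real.log (n / M) ≤ 2 * L + 2 * N := by
      have h1 : (n : ℝ) / M = t * L * (1 / c) := by
        rw [hMdef, hl, ht]
        field_simp
      rw [h1, Real.log_mul (by positivity) (by positivity),
        Real.log_mul (by positivity) (by positivity)]
      have h2 : Real.log t ≤ L := Real.log_le_log (by positivity) (by linarith)
      have h3 := Real.log_le_sub_one_of_pos (show 0 < L by linarith)
      linarith
    have hML : M * L = c * k := by
      rw [hMdef, hl]
      field_simp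
    refine (hasCover_sparse hu huv (by linarith) hMn ?_).mono_radius ?_
    · have h1 : ((k - 1 : ℕ) : ℝ) = k - 1 := by
        rw [Nat.cast_sub hk, Nat.cast_one]
      rw [h1]
      have h2 : M * (Real.log (n / M) + 2 * K + 2) ≤ k / 4 := by
        calc M * (Real.log (n / M) + 2 * K + 2) ≤ M * ((2 * L + 2 * N) + 2 * K + 2) := by gcongr
          _ = 2 * (M * L) + M * (2 * N + 2 * K + 2) := by ring
          _ ≤ 2 * (c * k) + 2 * c * k * (2 * N + 2 * K + 2) := by
              rw [hML]
              have h0 : 0 ≤ 2 * N + 2 * K + 2 := by linarith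
              linarith [mul_le_mul_of_nonneg_right hMk h0]
          _ = c * (2 + 2 * (2 * N) + 4 * K + 4) * k := by ring
          _ ≤ 1 / 4 * k := mul_le_mul_of_nonneg_right hcN (by linarith)
          _ = k / 4 := by ring
      have h3 : ((k : ℝ) - 1) * (1 / 2) ≤ (k - 1) * Real.log 2 :=
        mul_le_mul_of_nonneg_left (by linarith) (by linarith)
      linarith
    · have h1 : Real.log (l + 1) ≤ Q * Real.log M := by
        have h2 : l + 1 ≤ M * (2 / c) := by
          rw [hMdef]
          field_simp
          linarith
        have h3 := Real.log_le_log (by linarith) h2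
        rw [Real.log_mul (by positivity) (by positivity)] at h3
        have h4 : Real.log 2 ≤ Real.log M := Real.log_le_log two_pos hM
        have h5 : Real.log (2 / c) ≤ Real.log (2 / c) / Real.log 2 * Real.log M := by
          rw [div_mul_eq_mul_div, le_div_iff₀ (by linarith)]
          gcongr
        rw [hQ]
        linarith
      have := rpow_le_mul_rpow_of_le_mul hE hl0 hQ0 h1
      linarith

/-- Covers on a fine grid. -/
lemma hasCover_fine (hu : u ≠ 0) (huv : u < v) {B : ℝ} (hn : 0 < n) (hB : 1 ≤ B)
    (hk : (Real.exp (2 * (1 + 3 * logSizeConst u.toReal)) * (3 * B)) ^ n ≤ 2 ^ (k - 1)) :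
    HasCover n (lorentzNorm n ⊤ u) (lorentzNorm n ⊤ v) k
      (B⁻¹ * harmonicSum n ^ ((1 / v).toReal - (1 / u).toReal)) := by
  have hu' : u ≠ ⊤ := huv.ne_top
  have hv : v ≠ 0 := (hu.bot_lt.trans huv).ne'
  have ha : 0 < u.toReal := ENNReal.toReal_pos hu hu'
  have hB0 : 0 < B := one_pos.trans_le hB
  have hn1 : (1 : ℝ) ≤ n := by exact_mod_cast hn
  set D := harmonicSum n with hDdef
  have hD : 0 < D := one_pos.trans_le (one_le_harmonicSum hn)
  have hexp : Real.exp D ≤ 3 * n := by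
    have h1 := Real.exp_le_exp.2 (harmonicSum_le_one_add_log n)
    rw [Real.exp_add, Real.exp_log (by positivity)] at h1
    have := Real.exp_one_lt_d9
    nlinarith
  set p := 1 / u.toReal with hp
  set K := logSizeConst u.toReal
  have hK : 0 < K := logSizeConst_pos ha
  set δ := D ^ (-p) / B with hδdef
  have hδ : 0 < δ := by positivity
  set g : ℤ → ℝ := fun a => ((1 + (a.natAbs : ℝ) / B) ^ 2)⁻¹ with hg
  refine hasCover_of_grid (η := Real.exp (-(n * (2 * (1 + 3 * K))))) (G := 3 * B) hu hδ
    (Real.exp_pos _) g (fun a => by positivity) (fun R => ?_) (fun x hx w hw => ?_) ?_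
    (fun x z hx h1 h2 => ?_)
  · rw [sum_Icc_int_le (fun a : ℕ => ((1 + (a : ℝ) / B) ^ 2)⁻¹) R]
    have := sum_Icc_inv_one_add_div_sq_le hB0 R
    simp only [Nat.cast_zero, zero_div, add_zero, one_pow, inv_one]
    linarith
  · set S := (Finset.univ : Finset (Fin n)).filter (fun j => D ^ (-p) ≤ |x j|) with hS
    have hlog := sum_log_one_add_le hu hu' hx hD
    have hlog2 := Real.log_two_lt_d9
    have hj : ∀ j, Real.exp (-(2 * Real.log (1 + |x j| * D ^ p))) ≤ g (w j) := by
      intro j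
      have hwj : ((w j).natAbs : ℝ) / B ≤ |x j| * D ^ p := by
        rw [Nat.cast_natAbs, Int.cast_abs, ← div_rpow_neg_eq hD, div_le_iff₀ hB0]
        refine (hw j).trans (le_of_eq ?_)
        rw [hδdef]
        field_simp
      have h3 : Real.exp (-(2 * Real.log (1 + |x j| * D ^ p))) =
          ((1 + |x j| * D ^ p) ^ 2)⁻¹ := by
        rw [Real.exp_neg, two_mul, Real.exp_add, Real.exp_log (by positivity), sq]
      rw [h3]
      simp only [hg]
      gcongr
    have hsum : ∑ j, Real.log (1 + |x j| * D ^ p) ≤ n * (1 + 3 * K) := by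
      calc ∑ j, Real.log (1 + |x j| * D ^ p)
          ≤ ∑ j, ((if j ∈ S then Real.log (1 + |x j| * D ^ p) else 0) + 1) := by
            refine Finset.sum_le_sum fun j _ => ?_
            split_ifs with hjS
            · linarith
            · have h1 : |x j| < D ^ (-p) := by simpa [hS] using hjS
              have h2 : |x j| * D ^ p ≤ 1 := by
                rw [← div_rpow_neg_eq hD]
                exact (div_le_one (by positivity)).2 h1.le
              have h3 : 0 ≤ |x j| * D ^ p := by positivity
              have := Real.log_le_log (by linarith) (show 1 + |x j| * D ^ p ≤ 2 by linarith)
              linarith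
        _ = (∑ j ∈ S, Real.log (1 + |x j| * D ^ p)) + n := by
            rw [Finset.sum_add_distrib, ← Finset.sum_filter, Finset.filter_mem_eq_inter,
              Finset.univ_inter]
            simp
        _ ≤ n * (1 + 3 * K) := by
            have := mul_le_mul_of_nonneg_left hexp hK.le
            linarith
    calc Real.exp (-(n * (2 * (1 + 3 * K))))
        ≤ Real.exp (∑ j, -(2 * Real.log (1 + |x j| * D ^ p))) := by
          rw [Real.exp_le_exp, Finset.sum_neg_distrib, neg_le_neg_iff, ← Finset.mul_sum]
          linarith
      _ = ∏ j, Real.exp (-(2 * Real.log (1 + |x j| * D ^ p))) := Real.exp_sum _ _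
      _ ≤ ∏ j, g (w j) := Finset.prod_le_prod (fun _ _ => (Real.exp_pos _).le) fun j _ => hj j
  · rw [Real.exp_neg, ← div_eq_mul_inv, le_div_iff₀ (Real.exp_pos _), Real.exp_nat_mul,
      ← mul_pow, mul_comm]
    exact hk
  · refine (lorentzNorm_le_mul_harmonicSum_rpow hv hδ.le h1
      ((Finset.card_le_univ _).trans (by simp) : _ ≤ n)).trans (le_of_eq ?_)
    rw [← hDdef, hδdef, sub_eq_add_neg, Real.rpow_add hD, toReal_one_div u, ← hp]
    ring

lemma exists_hasCover_large (hu : u ≠ 0) (huv : u < v) :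
    ∃ C : ℝ, 0 < C ∧ ∀ n k : ℕ, 0 < n → n ≤ k →
      HasCover n (lorentzNorm n ⊤ u) (lorentzNorm n ⊤ v) k
        (C * ((2 : ℝ) ^ (-(k : ℝ) / (n : ℝ)) *
          Real.log ((n : ℝ) + 1) ^ ((1 / v).toReal - (1 / u).toReal))) := by
  obtain ⟨C₀, hC₀, hmid⟩ := exists_hasCover_mid hu huv
  have hE : (1 / v).toReal - (1 / u).toReal ≤ 0 := exponent_nonpos hu huv
  set E := (1 / v).toReal - (1 / u).toReal with hEdef
  set P := Real.exp (2 * (1 + 3 * logSizeConst u.toReal))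
  have hP : 0 < P := Real.exp_pos _
  set Q := 6 * P with hQ
  have hQ0 : 0 < Q := by positivity
  refine ⟨Q * C₀ + Q, by positivity, fun n k hn hnk => ?_⟩
  have hn1 : (1 : ℝ) ≤ n := by exact_mod_cast hn
  have hlog : 0 < Real.log ((n : ℝ) + 1) := Real.log_pos (by linarith)
  set q := (2 : ℝ) ^ ((k : ℝ) / n) with hq
  have hq0 : 0 < q := by positivity
  have hqinv : (2 : ℝ) ^ (-(k : ℝ) / (n : ℝ)) = q⁻¹ := by
    rw [neg_div, Real.rpow_neg two_pos.le]
  rw [hqinv]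
  have hX : 0 ≤ Real.log ((n : ℝ) + 1) ^ E := by positivity
  rcases lt_or_ge q Q with hqQ | hqQ
  · have h1 : Real.log ((n : ℝ) + 1) ≤ n := by
      have := Real.log_le_sub_one_of_pos (show (0 : ℝ) < n + 1 by positivity)
      linarith
    refine ((hmid n n hn h1 le_rfl).mono hnk).mono_radius ?_
    have h2 : Real.log ((n : ℝ) / Real.log ((n : ℝ) / n + 1) + 1) ^ E ≤
        Real.log ((n : ℝ) + 1) ^ E := by
      refine Real.rpow_le_rpow_of_nonpos hlog ?_ hE
      rw [div_self (by positivity), one_add_one_eq_two]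
      have h3 := Real.log_two_lt_d9
      have h4 := Real.log_two_gt_d9
      have h5 : (n : ℝ) ≤ n / Real.log 2 := by
        rw [le_div_iff₀ (by linarith)]
        nlinarith
      exact Real.log_le_log (by linarith) (by linarith)
    have h6 : 1 ≤ Q * q⁻¹ := by
      rw [← div_eq_mul_inv, one_le_div hq0]
      exact hqQ.le
    calc _ ≤ C₀ * Real.log ((n : ℝ) + 1) ^ E := by gcongr
      _ ≤ (Q * q⁻¹) * (C₀ * Real.log ((n : ℝ) + 1) ^ E) :=
          le_mul_of_one_le_left (by positivity) h6
      _ ≤ (Q * q⁻¹) * (C₀ * Real.log ((n : ℝ) + 1) ^ E) +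
            Q * (q⁻¹ * Real.log ((n : ℝ) + 1) ^ E) :=
          le_add_of_nonneg_right (by positivity)
      _ = _ := by ring
  · refine (hasCover_fine hu huv hn (B := q / Q) ((one_le_div hQ0).2 hqQ) ?_).mono_radius ?_
    · have h1 : P * (3 * (q / Q)) = q / 2 := by
        rw [hQ]
        field_simp
        ring
      have h2 : q ^ n = 2 ^ k := by
        rw [hq, ← Real.rpow_natCast, ← Real.rpow_mul two_pos.le,
          div_mul_cancel₀ _ (by positivity), Real.rpow_natCast]
      rw [h1, div_pow, h2, div_le_iff₀ (by positivity), ← pow_add]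
      exact pow_le_pow_right₀ one_le_two (by omega)
    · have h1 : harmonicSum n ^ E ≤ Real.log ((n : ℝ) + 1) ^ E :=
        Real.rpow_le_rpow_of_nonpos hlog (log_add_one_le_harmonicSum n) hE
      calc (q / Q)⁻¹ * harmonicSum n ^ E ≤ (q / Q)⁻¹ * Real.log ((n : ℝ) + 1) ^ E := by gcongr
        _ = Q * (q⁻¹ * Real.log ((n : ℝ) + 1) ^ E) := by
            rw [inv_div, div_eq_mul_inv]
            ring
        _ ≤ (Q * C₀ + Q) * (q⁻¹ * Real.log ((n : ℝ) + 1) ^ E) := by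
            have : 0 < Q * C₀ := by positivity
            gcongr
            linarith

end Upper

/-! ### Lower bounds -/

section Lower

variable {n k : ℕ} {u v : ℝ≥0∞}

lemma half_le_of_hasCover (hv : v ≠ 0) {ε : ℝ} (hk : 2 ^ (k - 1) < n)
    (h : HasCover n (lorentzNorm n ⊤ u) (lorentzNorm n ⊤ v) k ε) (hu : u ≠ 0) : 1 / 2 ≤ ε := by
  obtain ⟨T, hT, h⟩ := h
  have hball : ∀ i : Fin n, lorentzNorm n ⊤ u (Pi.single i 1) ≤ 1 := fun i => by
    refine (lorentzNorm_le_mul_harmonicSum_rpow (t := 1) (m := 1) hu zero_le_one (fun j => ?_)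
      ?_).trans (le_of_eq ?_)
    · by_cases hj : j = i
      · subst hj; simp
      · simp [hj]
    · refine (Finset.card_le_card (t := {i}) fun j hj => ?_).trans (by simp)
      rw [Finset.mem_singleton]
      by_contra hji
      simp [hji] at hj
    · simp [harmonicSum]
  choose y hyT hy using fun i => h (Pi.single i 1) (hball i)
  obtain ⟨i, -, j, -, hij, hyij⟩ := Finset.exists_ne_map_eq_of_card_lt_of_maps_to
    (s := (Finset.univ : Finset (Fin n))) (t := T) (by simpa using hT.trans_lt hk) (f := y)
    (fun i _ => hyT i)
  have h1 := (abs_le_lorentzNorm hv _ i).trans (hy i)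
  have h2 := (abs_le_lorentzNorm hv _ i).trans (hy j)
  rw [← hyij] at h2
  simp only [Pi.sub_apply, Pi.single_eq_same, Pi.single_eq_of_ne hij] at h1 h2
  rw [abs_le] at h1 h2
  linarith

/-- Among sufficiently many words over an alphabet with `q²` letters there are two that agree in
fewer than half of the positions. -/
lemma exists_few_agreements {m q : ℕ} (hq : 0 < q) (W : Finset (Fin m → Fin (q * q)))
    (w₀ : Fin m → Fin (q * q)) (hW : (2 * q) ^ m < W.card) :
    ∃ w ∈ W, 2 * (Finset.univ.filter fun j => w j = w₀ j).card < m := by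
  by_contra! hcon
  have hq1 : (1 : ℝ) ≤ q := by exact_mod_cast hq
  have h1 := card_mul_le_pow (Finset.univ : Finset (Fin (q * q))) W
    (fun j a => if a = w₀ j then (q : ℝ) ^ 2 else 1) ((q : ℝ) ^ m) (2 * (q : ℝ) ^ 2)
    (fun j a => by split_ifs <;> positivity) (fun _ _ _ => Finset.mem_univ _)
    (fun w hw => by
      rw [Finset.prod_ite, Finset.prod_const, Finset.prod_const, one_pow, mul_one, ← pow_mul]
      exact pow_le_pow_right₀ hq1 (hcon w hw))
    (fun j => by
      calc ∑ a, (if a = w₀ j then (q : ℝ) ^ 2 else 1)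
          ≤ ∑ a : Fin (q * q), ((if a = w₀ j then (q : ℝ) ^ 2 else 0) + 1) :=
            Finset.sum_le_sum fun a _ => by split_ifs <;> linarith
        _ = 2 * (q : ℝ) ^ 2 := by
            rw [Finset.sum_add_distrib]
            simp
            ring)
  rw [Fintype.card_fin, sq, ← mul_assoc, mul_pow _ (q : ℝ)] at h1
  have h2 : (W.card : ℝ) ≤ (2 * q) ^ m := le_of_mul_le_mul_right h1 (by positivity)
  have h3 : W.card ≤ (2 * q) ^ m := by exact_mod_cast h2
  omega

lemma le_of_hasCover_sparse (hu : u ≠ 0) (hv : v ≠ 0) {ε : ℝ} {m q s : ℕ} (hm : 0 < m)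
    (hq : 0 < q) (hmq : m * (q * q) ≤ n) (hcount : 2 ^ (k - 1) * (2 * q) ^ m < (q * q) ^ m)
    (hs : 0 < s) (hsm : 4 * s ≤ m + 3)
    (h : HasCover n (lorentzNorm n ⊤ u) (lorentzNorm n ⊤ v) k ε) :
    harmonicSum m ^ (-(1 / u).toReal) / 2 * harmonicSum s ^ (1 / v).toReal ≤ ε := by
  obtain ⟨T, hT, h⟩ := h
  set δ := harmonicSum m ^ (-(1 / u).toReal) with hδdef
  have hH : 0 < harmonicSum m := one_pos.trans_le (one_le_harmonicSum hm)
  have hδ : 0 < δ := by positivity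
  obtain ⟨e⟩ : Nonempty (Fin m × Fin (q * q) ↪ Fin n) :=
    Function.Embedding.nonempty_of_card_le (by simpa using hmq)
  set x : (Fin m → Fin (q * q)) → Fin n → ℝ :=
    fun w i => if ∃ j, e (j, w j) = i then δ else 0 with hx
  have hball : ∀ w, lorentzNorm n ⊤ u (x w) ≤ 1 := fun w => by
    refine (lorentzNorm_le_mul_harmonicSum_rpow (t := δ) (m := m) hu hδ.le (fun i => ?_)
      ?_).trans (le_of_eq ?_)
    · simp only [hx]
      split_ifs
      · exact (abs_of_pos hδ).le
      · simpa using hδ.le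
    · refine (Finset.card_le_card
        (t := (Finset.univ : Finset (Fin m)).image fun j => e (j, w j)) fun i hi => ?_).trans
        (Finset.card_image_le.trans (by simp))
      have hi' := (Finset.mem_filter.1 hi).2
      by_cases hex : ∃ j, e (j, w j) = i
      · obtain ⟨j, hj⟩ := hex
        exact Finset.mem_image.2 ⟨j, Finset.mem_univ _, hj⟩
      · simp only [hx, if_neg hex, abs_zero, lt_irrefl] at hi'
    · rw [hδdef, ← Real.rpow_add hH, neg_add_cancel, Real.rpow_zero]
  choose y hyT hy using fun w => h (x w) (hball w)
  obtain ⟨z, -, hz⟩ := Finset.exists_lt_card_fiber_of_mul_lt_card_of_maps_to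
    (s := (Finset.univ : Finset (Fin m → Fin (q * q)))) (t := T) (f := y) (n := (2 * q) ^ m)
    (fun w _ => hyT w)
    (by simpa using (Nat.mul_le_mul_right _ hT).trans_lt hcount)
  obtain ⟨w₀, hw₀⟩ := Finset.card_pos.1 ((Nat.zero_le _).trans_lt hz)
  obtain ⟨w, hw, hagree⟩ := exists_few_agreements hq _ w₀ hz
  have hyw := (Finset.mem_filter.1 hw).2
  have hyw₀ := (Finset.mem_filter.1 hw₀).2
  have hdiff := Finset.card_filter_add_card_filter_not (s := (Finset.univ : Finset (Fin m)))
    (fun j => w j = w₀ j)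
  rw [Finset.card_univ, Fintype.card_fin] at hdiff
  set A : (Fin m → Fin (q * q)) → Finset (Fin n) :=
    fun w' => Finset.univ.filter fun i => δ / 2 ≤ |(x w' - z) i| with hA
  have hsub : ((Finset.univ : Finset (Fin m)).filter fun j => ¬ w j = w₀ j).image
      (fun j => e (j, w j)) ⊆ A w ∪ A w₀ := by
    intro i hi
    obtain ⟨j, hj, rfl⟩ := Finset.mem_image.1 hi
    have hj' := (Finset.mem_filter.1 hj).2
    have h1 : x w (e (j, w j)) = δ := by
      simp only [hx]
      rw [if_pos ⟨j, rfl⟩]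
    have h2 : x w₀ (e (j, w j)) = 0 := by
      simp only [hx]
      refine if_neg ?_
      rintro ⟨j', hjj⟩
      have h3 := e.injective hjj
      rw [Prod.mk.injEq] at h3
      obtain ⟨rfl, h3⟩ := h3
      exact hj' h3.symm
    simp only [hA, Finset.mem_union, Finset.mem_filter, Finset.mem_univ, true_and,
      Pi.sub_apply, h1, h2]
    by_contra! hcon
    have h4 := abs_lt.1 hcon.1
    have h5 := abs_lt.1 hcon.2
    linarith
  have hcard := (Finset.card_le_card hsub).trans (Finset.card_union_le _ _)
  rw [Finset.card_image_of_injective _ (fun j j' hjj => by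
    have := e.injective hjj
    exact (Prod.mk.inj this).1)] at hcard
  have hlarge : s ≤ (A w).card ∨ s ≤ (A w₀).card := by omega
  rcases hlarge with hl | hl
  · have h1 := hy w
    rw [hyw] at h1
    exact (mul_harmonicSum_rpow_le_lorentzNorm hv (by positivity) hs hl).trans h1
  · have h1 := hy w₀
    rw [hyw₀] at h1
    exact (mul_harmonicSum_rpow_le_lorentzNorm hv (by positivity) hs hl).trans h1

/-- The coordinates in which a point of a ball of `ℓ_{∞,v}^n` is atypically large are few. -/
lemma sq_card_level_le (hv : v ≠ 0) (hn : 0 < n) {ε : ℝ} (hε : 0 < ε) {z : Fin n → ℝ}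
    (hz : lorentzNorm n ⊤ v z ≤ ε) :
    (((Finset.univ : Finset (Fin n)).filter
      (fun j => 2 * ε * (6 / harmonicSum n) ^ (1 / v).toReal ≤ |z j|)).card) ^ 2 ≤ n := by
  have hD : 0 < harmonicSum n := one_pos.trans_le (one_le_harmonicSum hn)
  set θ := (1 / v).toReal
  have hθ : 0 ≤ θ := ENNReal.toReal_nonneg
  set s := ((Finset.univ : Finset (Fin n)).filter
      (fun j => 2 * ε * (6 / harmonicSum n) ^ θ ≤ |z j|)).card with hs
  rcases Nat.eq_zero_or_pos s with h0 | h0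
  · simp [h0]
  have h1 := (mul_harmonicSum_rpow_le_lorentzNorm hv (by positivity) h0 hs.le).trans hz
  have hlt : harmonicSum s < harmonicSum n / 6 := by
    by_contra! hcon
    have h2 : (harmonicSum n / 6) ^ θ ≤ harmonicSum s ^ θ := by gcongr
    have h3 : (6 / harmonicSum n) ^ θ * (harmonicSum n / 6) ^ θ = 1 := by
      rw [← Real.mul_rpow (by positivity) (by positivity), div_mul_div_cancel₀ hD.ne',
        div_self (by norm_num), Real.one_rpow]
    have h4 : 2 * ε * (6 / harmonicSum n) ^ θ * (harmonicSum n / 6) ^ θ ≤ ε :=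
      le_trans (by gcongr) h1
    rw [mul_assoc, h3] at h4
    linarith
  have h5 := log_add_one_le_harmonicSum s
  have h6 := harmonicSum_le_three_mul_log hn
  have h7 : Real.log (((s : ℝ) + 1) ^ 2) < Real.log ((n : ℝ) + 1) := by
    rw [Real.log_pow]
    push_cast
    linarith
  have h8 := (Real.log_lt_log_iff (by positivity) (by positivity)).1 h7
  have h9 : (s + 1) ^ 2 < n + 1 := by exact_mod_cast h8
  nlinarith

lemma harmonicSum_rpow_mul_le_exp (hn : 0 < n) {θ : ℝ} (hθ : 0 ≤ θ) {s : ℕ} (hs : s ^ 2 ≤ n) :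
    (harmonicSum n ^ θ) ^ s ≤ Real.exp (2 * θ) ^ n := by
  have hn1 : (1 : ℝ) ≤ n := by exact_mod_cast hn
  have hD1 := one_le_harmonicSum hn
  have hD : 0 < harmonicSum n := one_pos.trans_le hD1
  have hs' : (s : ℝ) ≤ √n := Real.le_sqrt_of_sq_le (by exact_mod_cast hs)
  have h1 : Real.log (harmonicSum n) ≤ 2 * √n := by
    have h2 := Real.log_le_sub_one_of_pos hD
    have h3 := harmonicSum_le_one_add_log n
    have h4 := Real.log_sqrt (show (0 : ℝ) ≤ n by linarith)
    have h5 := Real.log_le_sub_one_of_pos (show 0 < √(n : ℝ) by positivity)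
    linarith
  have h6 : (s : ℝ) * Real.log (harmonicSum n) ≤ 2 * n := by
    calc (s : ℝ) * Real.log (harmonicSum n) ≤ √n * (2 * √n) :=
          mul_le_mul hs' h1 (Real.log_nonneg hD1) (Real.sqrt_nonneg _)
      _ = 2 * (√n * √n) := by ring
      _ = 2 * n := by rw [Real.mul_self_sqrt (by linarith)]
  rw [Real.rpow_def_of_pos hD, ← Real.exp_nat_mul, ← Real.exp_nat_mul, Real.exp_le_exp]
  nlinarith [mul_le_mul_of_nonneg_left h6 hθ]

lemma pow_le_of_hasCover (hu : u ≠ 0) (hv : v ≠ 0) (hn : 0 < n) {ε : ℝ} (hε : 0 < ε)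
    (h : HasCover n (lorentzNorm n ⊤ u) (lorentzNorm n ⊤ v) k ε) :
    (2 * harmonicSum n ^ (-(1 / u).toReal)) ^ n ≤
      2 ^ (k - 1) * (2 ^ n * ((2 * (2 * ε * (6 / harmonicSum n) ^ (1 / v).toReal)) ^ n *
        Real.exp (2 * (1 / v).toReal) ^ n)) := by
  obtain ⟨T, hT, h⟩ := h
  have hD : 0 < harmonicSum n := one_pos.trans_le (one_le_harmonicSum hn)
  set θ := (1 / v).toReal with hθdef
  have hθ : 0 ≤ θ := ENNReal.toReal_nonneg
  set ρ := harmonicSum n ^ (-(1 / u).toReal) with hρdef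
  have hρ : 0 < ρ := by positivity
  set t := 2 * ε * (6 / harmonicSum n) ^ θ with ht
  have ht0 : 0 < t := by positivity
  set r : Finset (Fin n) → Fin n → ℝ := fun S j => if j ∈ S then ε else t with hr
  have hr0 : ∀ S j, 0 ≤ r S j := fun S j => by
    simp only [hr]
    split_ifs <;> positivity
  set P := (Finset.univ : Finset (Finset (Fin n))).filter fun S => S.card ^ 2 ≤ n with hP
  have hcover : Set.Icc (fun _ : Fin n => -ρ) (fun _ => ρ) ⊆
      ⋃ a ∈ T ×ˢ P, Set.Icc (a.1 - r a.2) (a.1 + r a.2) := by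
    intro x hx
    have hxball : lorentzNorm n ⊤ u x ≤ 1 := by
      refine (lorentzNorm_le_mul_harmonicSum_rpow (t := ρ) (m := n) hu hρ.le
        (fun j => abs_le.2 ⟨hx.1 j, hx.2 j⟩)
        ((Finset.card_le_univ _).trans (by simp))).trans (le_of_eq ?_)
      rw [hρdef, ← Real.rpow_add hD, neg_add_cancel, Real.rpow_zero]
    obtain ⟨y, hyT, hy⟩ := h x hxball
    have hS := sq_card_level_le hv hn hε hy
    rw [← hθdef, ← ht] at hS
    set S := (Finset.univ : Finset (Fin n)).filter (fun j => t ≤ |(x - y) j|) with hSdef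
    have hj : ∀ j, |x j - y j| ≤ r S j := fun j => by
      simp only [hr]
      split_ifs with hjS
      · exact (abs_le_lorentzNorm hv (x - y) j).trans hy
      · have : |(x - y) j| < t := by simpa [hSdef] using hjS
        exact this.le
    refine Set.mem_biUnion (x := (y, S)) (Finset.mem_coe.2 (Finset.mem_product.2
      ⟨hyT, Finset.mem_filter.2 ⟨Finset.mem_univ _, hS⟩⟩)) ⟨fun j => ?_, fun j => ?_⟩
    · have := (abs_le.1 (hj j)).1
      simp only [Pi.sub_apply]
      linarith
    · have := (abs_le.1 (hj j)).2
      simp only [Pi.add_apply]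
      linarith
  have hbox : ∀ a ∈ T ×ˢ P, volume.real (Set.Icc (a.1 - r a.2) (a.1 + r a.2)) ≤
      (2 * t) ^ n * Real.exp (2 * θ) ^ n := by
    intro a ha
    have hcard := (Finset.mem_filter.1 (Finset.mem_product.1 ha).2).2
    rw [Measure.real, Real.volume_Icc_pi_toReal fun j => by
      have := hr0 a.2 j
      simp only [Pi.sub_apply, Pi.add_apply]
      linarith]
    calc ∏ j, ((a.1 + r a.2) j - (a.1 - r a.2) j)
        ≤ ∏ j, (2 * t) * (if j ∈ a.2 then harmonicSum n ^ θ else 1) := by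
          refine Finset.prod_le_prod (fun j _ => ?_) fun j _ => ?_
          · have := hr0 a.2 j
            simp only [Pi.sub_apply, Pi.add_apply]
            linarith
          · have h1 : (a.1 + r a.2) j - (a.1 - r a.2) j = 2 * r a.2 j := by
              simp only [Pi.sub_apply, Pi.add_apply]
              ring
            rw [h1]
            simp only [hr]
            split_ifs
            · have h2 : t * harmonicSum n ^ θ = 2 * ε * 6 ^ θ := by
                rw [ht, mul_assoc, ← Real.mul_rpow (by positivity) hD.le,
                  div_mul_cancel₀ _ hD.ne']
              have h3 : (1 : ℝ) ≤ 6 ^ θ := Real.one_le_rpow (by norm_num) hθ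
              have h4 := mul_le_mul_of_nonneg_left h3 hε.le
              rw [mul_assoc, h2]
              linarith
            · rw [mul_one]
      _ = (2 * t) ^ n * (harmonicSum n ^ θ) ^ a.2.card := by
          rw [Finset.prod_mul_distrib, Finset.prod_const, Finset.card_univ, Fintype.card_fin,
            Finset.prod_ite_mem, Finset.univ_inter, Finset.prod_const]
      _ ≤ (2 * t) ^ n * Real.exp (2 * θ) ^ n := by
          have := harmonicSum_rpow_mul_le_exp hn hθ hcard
          gcongr
  have hvol : volume.real (Set.Icc (fun _ : Fin n => -ρ) (fun _ => ρ)) = (2 * ρ) ^ n := by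
    rw [Measure.real, Real.volume_Icc_pi_toReal fun j => by linarith, Finset.prod_const,
      Finset.card_univ, Fintype.card_fin]
    ring
  have hfin : volume (⋃ a ∈ T ×ˢ P, Set.Icc (a.1 - r a.2) (a.1 + r a.2)) ≠ ⊤ :=
    ((measure_biUnion_lt_top (Finset.finite_toSet (T ×ˢ P))
      fun a _ => isCompact_Icc.measure_lt_top)).ne
  have hPcard : P.card ≤ 2 ^ n := (Finset.card_le_univ _).trans (by simp)
  have hcard : ((T ×ˢ P).card : ℝ) ≤ 2 ^ (k - 1) * 2 ^ n := by
    rw [Finset.card_product]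
    exact_mod_cast Nat.mul_le_mul hT hPcard
  calc (2 * ρ) ^ n ≤ volume.real (⋃ a ∈ T ×ˢ P, Set.Icc (a.1 - r a.2) (a.1 + r a.2)) := by
        rw [← hvol]
        exact measureReal_mono hcover hfin
    _ ≤ ∑ a ∈ T ×ˢ P, volume.real (Set.Icc (a.1 - r a.2) (a.1 + r a.2)) :=
        measureReal_biUnion_finset_le _ _
    _ ≤ (T ×ˢ P).card • ((2 * t) ^ n * Real.exp (2 * θ) ^ n) := Finset.sum_le_card_nsmul _ _ _ hbox
    _ ≤ (2 ^ (k - 1) * 2 ^ n) * ((2 * t) ^ n * Real.exp (2 * θ) ^ n) := by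
        rw [nsmul_eq_mul]
        gcongr
    _ = _ := by ring

/-- The volume bound, valid for all `k`. -/
lemma volume_lower_bound (hu : u ≠ 0) (huv : u < v) :
    ∃ c : ℝ, 0 < c ∧ ∀ n k : ℕ, 0 < n → 0 < k → ∀ ε : ℝ, 0 < ε →
      HasCover n (lorentzNorm n ⊤ u) (lorentzNorm n ⊤ v) k ε →
      c * ((2 : ℝ) ^ (-(k : ℝ) / (n : ℝ)) *
        Real.log ((n : ℝ) + 1) ^ ((1 / v).toReal - (1 / u).toReal)) ≤ ε := by
  have hv : v ≠ 0 := (hu.bot_lt.trans huv).ne'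
  set θ := (1 / v).toReal with hθdef
  set p := (1 / u).toReal with hp
  have hE : θ - p ≤ 0 := exponent_nonpos hu huv
  set K := Real.exp (2 * θ) * 4 * 6 ^ θ with hK
  have hK0 : 0 < K := by positivity
  refine ⟨(K * 3 ^ (-(θ - p)))⁻¹, by positivity, fun n k hn hk ε hε h => ?_⟩
  have h1 := pow_le_of_hasCover hu hv hn hε h
  rw [← hθdef, ← hp] at h1
  have hD : 0 < harmonicSum n := one_pos.trans_le (one_le_harmonicSum hn)
  have hn1 : (1 : ℝ) ≤ n := by exact_mod_cast hn
  set D := harmonicSum n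
  set q := (2 : ℝ) ^ ((k : ℝ) / n) with hq
  have hq0 : 0 < q := by positivity
  have hqn : q ^ n = 2 ^ k := by
    rw [hq, ← Real.rpow_natCast, ← Real.rpow_mul two_pos.le,
      div_mul_cancel₀ _ (by positivity), Real.rpow_natCast]
  have h2 : (2 * D ^ (-p)) ^ n ≤ (2 * (q * K * ε * D ^ (-θ))) ^ n := by
    refine h1.trans ?_
    have h3 : (2 * (q * K * ε * D ^ (-θ))) ^ n = 2 ^ k *
        (2 ^ n * ((2 * (2 * ε * (6 / D) ^ θ)) ^ n * Real.exp (2 * θ) ^ n)) := by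
      rw [← hqn, ← mul_pow, ← mul_pow, ← mul_pow, hK, Real.div_rpow (by norm_num) hD.le,
        Real.rpow_neg hD.le]
      congr 1
      ring
    rw [h3]
    gcongr
    · exact one_le_two
    · omega
  have h4 := (pow_le_pow_iff_left₀ (by positivity) (by positivity) hn.ne').1 h2
  have h5 : D ^ (θ - p) ≤ q * K * ε := by
    have h6 : D ^ (-p) ≤ q * K * ε * D ^ (-θ) := by linarith
    rw [Real.rpow_neg hD.le θ, ← div_eq_mul_inv, le_div_iff₀ (by positivity), ← Real.rpow_add hD]
      at h6
    rwa [show θ - p = -p + θ by ring]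
  have h7 := rpow_le_mul_rpow_of_le_mul hE hD (by norm_num : (0 : ℝ) < 3)
    (harmonicSum_le_three_mul_log hn)
  have hqinv : (2 : ℝ) ^ (-(k : ℝ) / (n : ℝ)) = q⁻¹ := by
    rw [neg_div, Real.rpow_neg two_pos.le]
  rw [hqinv, inv_mul_le_iff₀ (by positivity), inv_mul_le_iff₀ hq0]
  calc Real.log ((n : ℝ) + 1) ^ (θ - p) ≤ 3 ^ (-(θ - p)) * D ^ (θ - p) := h7
    _ ≤ 3 ^ (-(θ - p)) * (q * K * ε) := by gcongr
    _ = _ := by ring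

lemma log_mul_add_one_le (N : ℕ) {l : ℝ} (hl : 0 ≤ l) :
    Real.log (N * l + 1) ≤ N * Real.log (l + 1) := by
  rw [← Real.log_pow]
  refine Real.log_le_log (by positivity) ?_
  have := one_add_mul_le_pow (show (-2 : ℝ) ≤ l by linarith) N
  rw [add_comm l 1]
  linarith

lemma sparse_count {m q : ℕ} (hk : 0 < k) (hq : 0 < q) (h : (2 : ℝ) ^ k * 2 ^ m ≤ q ^ m) :
    2 ^ (k - 1) * (2 * q) ^ m < (q * q) ^ m := by
  have h1 : 2 ^ k * 2 ^ m ≤ q ^ m := by exact_mod_cast h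
  have h2 : 2 ^ (k - 1) < 2 ^ k := Nat.pow_lt_pow_right one_lt_two (by omega)
  calc 2 ^ (k - 1) * (2 * q) ^ m = 2 ^ (k - 1) * (2 ^ m * q ^ m) := by rw [mul_pow]
    _ < 2 ^ k * (2 ^ m * q ^ m) := Nat.mul_lt_mul_of_pos_right h2 (by positivity)
    _ = (2 ^ k * 2 ^ m) * q ^ m := by ring
    _ ≤ q ^ m * q ^ m := Nat.mul_le_mul_right _ h1
    _ = (q * q) ^ m := by rw [mul_pow]

/-- The parameters of the code used for the lower bound in the sparse range. -/
lemma exists_sparse_code (hk : 0 < k) (hn : Real.log ((n : ℝ) + 1) ≤ k)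
    (hkn : 32768 * (k : ℝ) ≤ n) :
    ∃ m q : ℕ, 0 < m ∧ 0 < q ∧ m * (q * q) ≤ n ∧ 2 ^ (k - 1) * (2 * q) ^ m < (q * q) ^ m ∧
      (m : ℝ) ≤ 8 * ((k : ℝ) / Real.log ((n : ℝ) / k + 1)) := by
  have hk' : (1 : ℝ) ≤ k := by exact_mod_cast hk
  have hkn' : k ≤ n := by
    have : (k : ℝ) ≤ n := by linarith
    exact_mod_cast this
  set t := (n : ℝ) / k with ht
  have ht1 : 32768 ≤ t := (le_div_iff₀ (by positivity)).2 hkn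
  set L := Real.log (t + 1) with hL
  have hL1 : 1 ≤ L := by
    rw [hL, Real.le_log_iff_exp_le (by linarith)]
    have := Real.exp_one_lt_d9
    linarith
  set l := (k : ℝ) / L with hl
  have hl1 : 1 ≤ l := one_le_div_log hk hn hkn'
  set m := ⌈4 * l⌉₊ with hm
  have hm1 : 4 * l ≤ m := Nat.le_ceil _
  have hm2 : (m : ℝ) < 4 * l + 1 := Nat.ceil_lt_add_one (by linarith)
  have hm0 : 0 < m := Nat.ceil_pos.2 (by linarith)
  have hm8 : (m : ℝ) ≤ 8 * l := by linarith
  set q := Nat.sqrt (n / m) with hq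
  have hmq : m * (q * q) ≤ n :=
    (Nat.mul_le_mul_left _ (Nat.sqrt_le _)).trans (Nat.mul_div_le n m)
  have hnq : (n : ℝ) < m * ((q + 1) * (q + 1)) := by
    have h1 : n / m < (q + 1) * (q + 1) := Nat.lt_succ_sqrt _
    rw [Nat.div_lt_iff_lt_mul hm0, mul_comm] at h1
    exact_mod_cast h1
  set r := Real.exp (L / 4) with hr
  have hr4 : r ^ 4 = t + 1 := by
    rw [hr, ← Real.exp_nat_mul]
    push_cast
    rw [mul_div_cancel₀ _ (by norm_num), hL, Real.exp_log (by linarith)]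
  have hr1 : 1 ≤ r := Real.one_le_exp (by linarith)
  have htq : t < 8 * ((q : ℝ) + 1) ^ 2 := by
    have h1 : (n : ℝ) = t * L * l := by
      rw [ht, hl]
      field_simp
    have h2 : t * l ≤ n := by
      rw [h1]
      have : 0 ≤ t * l := by positivity
      nlinarith
    have h3 : t * l < 8 * ((q : ℝ) + 1) ^ 2 * l := by
      have h4 : (m : ℝ) * ((q + 1) * (q + 1)) ≤ 8 * l * ((q + 1) * (q + 1)) := by gcongr
      linarith
    exact lt_of_mul_lt_mul_right h3 (by linarith)
  have hqr : 2 * r ≤ q := by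
    by_contra! hcon
    have h1 : ((q : ℝ) + 1) ^ 2 ≤ (3 * r) ^ 2 := by
      gcongr
      linarith
    have h2 : (181 : ℝ) ≤ r ^ 2 := by
      by_contra! h3
      have : (r ^ 2) ^ 2 < 181 ^ 2 := by gcongr
      have h4 : (r ^ 2) ^ 2 = r ^ 4 := by ring
      rw [h4, hr4] at this
      linarith
    nlinarith
  have hq0 : 0 < q := by
    have : (0 : ℝ) < q := by linarith
    exact_mod_cast this
  refine ⟨m, q, hm0, hq0, hmq, sparse_count hk hq0 ?_, hm8⟩
  have h2k : (2 : ℝ) ^ k ≤ r ^ m := by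
    calc (2 : ℝ) ^ k ≤ Real.exp 1 ^ k := by
          have := Real.exp_one_gt_d9
          gcongr
          linarith
      _ = Real.exp k := by rw [← Real.exp_nat_mul, mul_one]
      _ ≤ Real.exp (m * (L / 4)) := by
          refine Real.exp_le_exp.2 ?_
          have h1 : (k : ℝ) = 4 * l * (L / 4) := by
            rw [hl]
            field_simp
          rw [h1]
          gcongr
      _ = r ^ m := by rw [hr, ← Real.exp_nat_mul]
  calc (2 : ℝ) ^ k * 2 ^ m ≤ r ^ m * 2 ^ m := by gcongr
    _ = (2 * r) ^ m := by rw [← mul_pow, mul_comm]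
    _ ≤ q ^ m := by gcongr

lemma exists_lower_mid_sparse (hu : u ≠ 0) (huv : u < v) :
    ∃ c : ℝ, 0 < c ∧ ∀ n k : ℕ, 0 < k → Real.log ((n : ℝ) + 1) ≤ k → 32768 * (k : ℝ) ≤ n →
      ∀ ε : ℝ, HasCover n (lorentzNorm n ⊤ u) (lorentzNorm n ⊤ v) k ε →
      c * Real.log ((k : ℝ) / Real.log ((n : ℝ) / k + 1) + 1) ^
        ((1 / v).toReal - (1 / u).toReal) ≤ ε := by
  have hv : v ≠ 0 := (hu.bot_lt.trans huv).ne'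
  have hE : (1 / v).toReal - (1 / u).toReal ≤ 0 := exponent_nonpos hu huv
  set θ := (1 / v).toReal with hθdef
  set p := (1 / u).toReal with hp
  have hθ : 0 ≤ θ := ENNReal.toReal_nonneg
  have hp0 : 0 ≤ p := ENNReal.toReal_nonneg
  refine ⟨3 ^ (-p) / 2 * (1 / 4) ^ θ * 8 ^ (θ - p), by positivity,
    fun n k hk hn hkn ε h => ?_⟩
  obtain ⟨m, q, hm, hq, hmq, hcount, hm8⟩ := exists_sparse_code hk hn hkn
  set s := (m + 3) / 4 with hs
  have h1 := le_of_hasCover_sparse hu hv hm hq hmq hcount (s := s) (by omega) (by omega) h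
  rw [← hθdef, ← hp] at h1
  refine le_trans ?_ h1
  set l := (k : ℝ) / Real.log ((n : ℝ) / k + 1) with hl
  have hm1 : (1 : ℝ) ≤ m := by exact_mod_cast hm
  have hl0 : 0 < l := by linarith
  set Z := Real.log ((m : ℝ) + 1) with hZ
  have hZ0 : 0 < Z := Real.log_pos (by linarith)
  have hll : 0 < Real.log (l + 1) := Real.log_pos (by linarith)
  have hHs : 1 / 4 * Z ≤ harmonicSum s := by
    have h2 := log_mul_add_one_le 4 (Nat.cast_nonneg (α := ℝ) s)
    have h3 : (m : ℝ) ≤ (4 : ℕ) * (s : ℝ) := by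
      have : m ≤ 4 * s := by omega
      exact_mod_cast this
    have h4 : Z ≤ Real.log ((4 : ℕ) * (s : ℝ) + 1) :=
      Real.log_le_log (by linarith) (by linarith)
    have h5 := log_add_one_le_harmonicSum s
    push_cast at h2 h4
    linarith
  have hHm : harmonicSum m ≤ 3 * Z := harmonicSum_le_three_mul_log hm
  have hHm0 : 0 < harmonicSum m := one_pos.trans_le (one_le_harmonicSum hm)
  have hZl : Z ≤ 8 * Real.log (l + 1) := by
    have h2 := log_mul_add_one_le 8 hl0.le
    push_cast at h2
    exact (Real.log_le_log (by linarith) (by linarith)).trans h2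
  have h6 : (8 * Real.log (l + 1)) ^ (θ - p) ≤ Z ^ (θ - p) :=
    Real.rpow_le_rpow_of_nonpos hZ0 hZl hE
  have h7 : (3 * Z) ^ (-p) ≤ harmonicSum m ^ (-p) :=
    Real.rpow_le_rpow_of_nonpos hHm0 hHm (by linarith)
  have h8 : (1 / 4 * Z) ^ θ ≤ harmonicSum s ^ θ := by gcongr
  calc 3 ^ (-p) / 2 * (1 / 4) ^ θ * 8 ^ (θ - p) * Real.log (l + 1) ^ (θ - p)
      = 3 ^ (-p) / 2 * (1 / 4) ^ θ * (8 * Real.log (l + 1)) ^ (θ - p) := by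
        rw [Real.mul_rpow (by norm_num) hll.le]
        ring
    _ ≤ 3 ^ (-p) / 2 * (1 / 4) ^ θ * Z ^ (θ - p) := by gcongr
    _ = (3 * Z) ^ (-p) / 2 * (1 / 4 * Z) ^ θ := by
        rw [Real.mul_rpow (by norm_num) hZ0.le, Real.mul_rpow (by norm_num) hZ0.le,
          sub_eq_add_neg, Real.rpow_add hZ0]
        ring
    _ ≤ harmonicSum m ^ (-p) / 2 * harmonicSum s ^ θ := by gcongr

lemma exists_lower_mid_dense (hu : u ≠ 0) (huv : u < v) (N : ℕ) (hN : 1 ≤ N) :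
    ∃ c : ℝ, 0 < c ∧ ∀ n k : ℕ, 0 < k → k ≤ n → (n : ℝ) ≤ N * (k : ℝ) →
      ∀ ε : ℝ, 0 < ε → HasCover n (lorentzNorm n ⊤ u) (lorentzNorm n ⊤ v) k ε →
      c * Real.log ((k : ℝ) / Real.log ((n : ℝ) / k + 1) + 1) ^
        ((1 / v).toReal - (1 / u).toReal) ≤ ε := by
  obtain ⟨c, hc, hvol⟩ := volume_lower_bound hu huv
  have hE : (1 / v).toReal - (1 / u).toReal ≤ 0 := exponent_nonpos hu huv
  set E := (1 / v).toReal - (1 / u).toReal with hEdef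
  have hN1 : (1 : ℝ) ≤ N := by exact_mod_cast hN
  refine ⟨c * (2⁻¹ * ((N ^ 2 : ℕ) : ℝ) ^ E), by positivity, fun n k hk hkn hnk ε hε h => ?_⟩
  have hk' : (1 : ℝ) ≤ k := by exact_mod_cast hk
  have hkn' : (k : ℝ) ≤ n := by exact_mod_cast hkn
  have hn : 0 < n := hk.trans_le hkn
  have h1 := hvol n n hn hn ε hε (h.mono hkn)
  refine le_trans ?_ h1
  have h2 : (2 : ℝ) ^ (-(n : ℝ) / (n : ℝ)) = 2⁻¹ := by
    rw [neg_div, div_self (by positivity), Real.rpow_neg_one]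
  rw [h2, mul_assoc, mul_assoc]
  set t := (n : ℝ) / k with ht
  have ht1 : 1 ≤ t := (one_le_div (by positivity)).2 hkn'
  have htN : t ≤ N := (div_le_iff₀ (by positivity)).2 hnk
  have hL : 0 < Real.log (t + 1) := Real.log_pos (by linarith)
  have hLN : Real.log (t + 1) ≤ N := by
    have := Real.log_le_sub_one_of_pos (show 0 < t + 1 by linarith)
    linarith
  set l := (k : ℝ) / Real.log (t + 1) with hl
  have hl0 : 0 < l := by positivity
  have hnl : (n : ℝ) ≤ (N ^ 2 : ℕ) * l := by
    have h3 : (k : ℝ) ≤ N * l := by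
      calc (k : ℝ) = Real.log (t + 1) * l := by
            rw [hl]
            field_simp
        _ ≤ N * l := by gcongr
    calc (n : ℝ) ≤ N * k := hnk
      _ ≤ N * (N * l) := by gcongr
      _ = (N ^ 2 : ℕ) * l := by push_cast; ring
  have hlog : Real.log ((n : ℝ) + 1) ≤ (N ^ 2 : ℕ) * Real.log (l + 1) :=
    (Real.log_le_log (by positivity) (by linarith)).trans (log_mul_add_one_le (N ^ 2) hl0.le)
  have hll : 0 < Real.log (l + 1) := Real.log_pos (by linarith)
  have hln : 0 < Real.log ((n : ℝ) + 1) := Real.log_pos (by linarith)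
  have h4 := Real.rpow_le_rpow_of_nonpos hln hlog hE
  rw [Real.mul_rpow (Nat.cast_nonneg _) hll.le] at h4
  gcongr

lemma two_pow_pred_lt (hk : 0 < k) (h : (k : ℝ) ≤ Real.log ((n : ℝ) + 1)) : 2 ^ (k - 1) < n := by
  have h1 : (2 : ℝ) ^ k < n + 1 := by
    calc (2 : ℝ) ^ k < Real.exp 1 ^ k := by
          have := Real.exp_one_gt_d9
          exact pow_lt_pow_left₀ (by linarith) two_pos.le hk.ne'
      _ = Real.exp k := by rw [← Real.exp_nat_mul, mul_one]
      _ ≤ n + 1 := (Real.le_log_iff_exp_le (by positivity)).1 h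
  have h2 : 2 ^ k < n + 1 := by exact_mod_cast h1
  have h3 : 2 ^ (k - 1) < 2 ^ k := Nat.pow_lt_pow_right one_lt_two (by omega)
  omega

end Lower

/-- Case (IV.2) of the main theorem: for `p = q = ∞` and `0 < u < v ≤ ∞`, with
`ℓ(k,n) = k / log(n/k + 1)`, the entropy numbers `e_k(id : ℓ_{∞,u}^n → ℓ_{∞,v}^n)` are,
uniformly in `k` and `n`, equivalent to `1` for `1 ≤ k ≤ log(n+1)`, to
`(log(ℓ(k,n)+1))^{1/v - 1/u}` for `log(n+1) ≤ k ≤ n`, and to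
`2^{-k/n} (log(n+1))^{1/v - 1/u}` for `k ≥ n`. -/
theorem entropy_lorentz_inftyu_inftyv_of_lt
    (u v : ℝ≥0∞) (hu : 0 < u) (huv : u < v) :
    ∃ c C : ℝ, 0 < c ∧ 0 < C ∧ ∀ n : ℕ, 0 < n →
      (∀ k : ℕ, 1 ≤ k → (k : ℝ) ≤ Real.log ((n : ℝ) + 1) →
        c ≤ entropyNumber n (lorentzNorm n ⊤ u) (lorentzNorm n ⊤ v) k ∧
          entropyNumber n (lorentzNorm n ⊤ u) (lorentzNorm n ⊤ v) k ≤ C) ∧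
      (∀ k : ℕ, Real.log ((n : ℝ) + 1) ≤ (k : ℝ) → k ≤ n →
        c * Real.log ((k : ℝ) / Real.log ((n : ℝ) / (k : ℝ) + 1) + 1) ^
              ((1 / v).toReal - (1 / u).toReal) ≤
            entropyNumber n (lorentzNorm n ⊤ u) (lorentzNorm n ⊤ v) k ∧
          entropyNumber n (lorentzNorm n ⊤ u) (lorentzNorm n ⊤ v) k ≤
            C * Real.log ((k : ℝ) / Real.log ((n : ℝ) / (k : ℝ) + 1) + 1) ^
              ((1 / v).toReal - (1 / u).toReal)) ∧
      (∀ k : ℕ, n ≤ k →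
        c * ((2 : ℝ) ^ (-(k : ℝ) / (n : ℝ)) *
              Real.log ((n : ℝ) + 1) ^ ((1 / v).toReal - (1 / u).toReal)) ≤
            entropyNumber n (lorentzNorm n ⊤ u) (lorentzNorm n ⊤ v) k ∧
          entropyNumber n (lorentzNorm n ⊤ u) (lorentzNorm n ⊤ v) k ≤
            C * ((2 : ℝ) ^ (-(k : ℝ) / (n : ℝ)) *
              Real.log ((n : ℝ) + 1) ^ ((1 / v).toReal - (1 / u).toReal))) := by
  have hu0 : u ≠ 0 := hu.ne'
  have hv0 : v ≠ 0 := (hu.trans huv).ne'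
  obtain ⟨C₁, hC₁, hmid⟩ := exists_hasCover_mid hu0 huv
  obtain ⟨C₂, hC₂, hlarge⟩ := exists_hasCover_large hu0 huv
  obtain ⟨c₁, hc₁, hvol⟩ := volume_lower_bound hu0 huv
  obtain ⟨c₂, hc₂, hsparse⟩ := exists_lower_mid_sparse hu0 huv
  obtain ⟨c₃, hc₃, hdense⟩ := exists_lower_mid_dense hu0 huv 32768 (by norm_num)
  set c := min (min (1 / 2) c₁) (min c₂ c₃)
  set C := max 1 (max C₁ C₂)
  have hcc : c ≤ 1 / 2 := (min_le_left _ _).trans (min_le_left _ _)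
  have hcc₁ : c ≤ c₁ := (min_le_left _ _).trans (min_le_right _ _)
  have hcc₂ : c ≤ c₂ := (min_le_right _ _).trans (min_le_left _ _)
  have hcc₃ : c ≤ c₃ := (min_le_right _ _).trans (min_le_right _ _)
  have hCC₁ : C₁ ≤ C := (le_max_left _ _).trans (le_max_right _ _)
  have hCC₂ : C₂ ≤ C := (le_max_right _ _).trans (le_max_right _ _)
  refine ⟨c, C, lt_min (lt_min (by norm_num) hc₁) (lt_min hc₂ hc₃),
    one_pos.trans_le (le_max_left _ _), fun n hn => ⟨fun k hk hkn => ⟨?_, ?_⟩,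
      fun k hnk hkn => ?_, fun k hnk => ?_⟩⟩
  · exact le_entropyNumber hu0 huv fun ε _ h =>
      hcc.trans (half_le_of_hasCover hv0 (two_pow_pred_lt hk hkn) h hu0)
  · exact (entropyNumber_le one_pos (hasCover_one_of_lt hu0 huv)).trans (le_max_left _ _)
  · have hn1 : (1 : ℝ) ≤ n := by exact_mod_cast hn
    have hk : 0 < k := by
      have h1 : 0 < Real.log ((n : ℝ) + 1) := Real.log_pos (by linarith)
      exact_mod_cast h1.trans_le hnk
    have hX : 0 < Real.log ((k : ℝ) / Real.log ((n : ℝ) / k + 1) + 1) ^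
        ((1 / v).toReal - (1 / u).toReal) := by
      have h1 := one_le_div_log hk hnk hkn
      exact Real.rpow_pos_of_pos (Real.log_pos (by linarith)) _
    refine ⟨le_entropyNumber hu0 huv fun ε hε h => ?_, ?_⟩
    · rcases le_total (32768 * (k : ℝ)) n with hA | hA
      · exact (mul_le_mul_of_nonneg_right hcc₂ hX.le).trans (hsparse n k hk hnk hA ε h)
      · exact (mul_le_mul_of_nonneg_right hcc₃ hX.le).trans
          (hdense n k hk hkn (by exact_mod_cast hA) ε hε h)
    · exact (entropyNumber_le (mul_pos hC₁ hX) (hmid n k hk hnk hkn)).trans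
        (mul_le_mul_of_nonneg_right hCC₁ hX.le)
  · have hn1 : (1 : ℝ) ≤ n := by exact_mod_cast hn
    have hX : 0 < (2 : ℝ) ^ (-(k : ℝ) / (n : ℝ)) *
        Real.log ((n : ℝ) + 1) ^ ((1 / v).toReal - (1 / u).toReal) :=
      mul_pos (by positivity) (Real.rpow_pos_of_pos (Real.log_pos (by linarith)) _)
    refine ⟨le_entropyNumber hu0 huv fun ε hε h => ?_, ?_⟩
    · exact (mul_le_mul_of_nonneg_right hcc₁ hX.le).trans
        (hvol n k hn (hn.trans_le hnk) ε hε h)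
    · exact (entropyNumber_le (mul_pos hC₂ hX) (hlarge n k hn hnk)).trans
        (mul_le_mul_of_nonneg_right hCC₂ hX.le)
end

section
/- For every constant C₀ ≥ 1 there exists a constant K ≥ 1 depending only on C₀ such that the following holds: for every n ∈ ℕ, every quasi-norm ‖·‖ on ℝ^n with quasi-norm constant at most C₀ that is 1-unconditional with respect to the standard basis (i.e., ‖(ε_1 a_1, …, ε_n a_n)‖ = ‖(a_1, …, a_n)‖ for all signs ε_i ∈ {−1, 1}), and all vectors a, b ∈ ℝ^n with |b_i| ≤ |a_i| for all 1 ≤ i ≤ n, one has ‖b‖ ≤ K ‖a‖. -/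
/-- `N` is a quasi-norm on `ℝ^n` with quasi-norm constant at most `C`. -/
def IsQuasiNormWith (n : ℕ) (C : ℝ) (N : (Fin n → ℝ) → ℝ) : Prop :=
  (∀ x, 0 ≤ N x) ∧ (∀ x, N x = 0 ↔ x = 0) ∧
  (∀ (a : ℝ) (x : Fin n → ℝ), N (a • x) = |a| * N x) ∧
  (∀ x y : Fin n → ℝ, N (x + y) ≤ C * (N x + N y))

/-- `N` is `1`-unconditional with respect to the standard basis of `ℝ^n`. -/
def IsUnconditional (n : ℕ) (N : (Fin n → ℝ) → ℝ) : Prop :=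
  ∀ (x ε : Fin n → ℝ), (∀ i, ε i = 1 ∨ ε i = -1) →
    N (fun i => ε i * x i) = N x

/-- `N` is `1`-symmetric with respect to the standard basis of `ℝ^n`. -/
def IsSymmetricNorm (n : ℕ) (N : (Fin n → ℝ) → ℝ) : Prop :=
  ∀ (x ε : Fin n → ℝ) (π : Equiv.Perm (Fin n)), (∀ i, ε i = 1 ∨ ε i = -1) →
    N (fun i => ε i * x (π i)) = N x

/-- Quasi-triangle inequality for finite sums. -/
lemma IsQuasiNormWith.sum_le {n : ℕ} {C : ℝ} {N : (Fin n → ℝ) → ℝ} (hC : 1 ≤ C)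
    (hN : IsQuasiNormWith n C N) {ι : Type*} (s : Finset ι) (y : ι → Fin n → ℝ) :
    N (∑ i ∈ s, y i) ≤ C ^ s.card * ∑ i ∈ s, N (y i) := by
  classical
  obtain ⟨hpos, hzero, -, htri⟩ := hN
  induction s using Finset.induction_on with
  | empty => simp [(hzero 0).2 rfl]
  | insert j s hj ih =>
    rw [Finset.sum_insert hj, Finset.sum_insert hj, Finset.card_insert_of_notMem hj, pow_succ']
    have h1 : N (y j) ≤ C ^ s.card * N (y j) :=
      le_mul_of_one_le_left (hpos _) (one_le_pow₀ hC)
    calc N (y j + ∑ i ∈ s, y i) ≤ C * (N (y j) + N (∑ i ∈ s, y i)) := htri _ _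
      _ ≤ C * (C ^ s.card * N (y j) + C ^ s.card * ∑ i ∈ s, N (y i)) := by gcongr
      _ = C * C ^ s.card * (N (y j) + ∑ i ∈ s, N (y i)) := by ring

/-- A quasi-norm on `ℝ^n` is bounded on every coordinate box. -/
lemma IsQuasiNormWith.exists_bound_of_abs_le {n : ℕ} {C : ℝ} {N : (Fin n → ℝ) → ℝ} (hC : 1 ≤ C)
    (hN : IsQuasiNormWith n C N) (a : Fin n → ℝ) :
    ∃ B : ℝ, ∀ x : Fin n → ℝ, (∀ i, |x i| ≤ |a i|) → N x ≤ B := by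
  refine ⟨C ^ (Finset.univ : Finset (Fin n)).card *
    ∑ i, |a i| * N (Pi.single i 1), fun x hx => ?_⟩
  have hsum : x = ∑ i, x i • (Pi.single i 1 : Fin n → ℝ) := pi_eq_sum_univ' x
  have h := hN.sum_le hC Finset.univ fun i => x i • (Pi.single i 1 : Fin n → ℝ)
  rw [← hsum] at h
  refine h.trans ?_
  gcongr with i
  rw [hN.2.2.1]
  exact mul_le_mul_of_nonneg_right (hx i) (hN.1 _)

/-- Truncated binary expansion with digits `±1`: every multiplier `t` with values in `[-1, 1]` is,
up to a remainder of size `2⁻ᵐ`, a multiplier whose action is bounded in terms of `C` and `m`. -/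
lemma exists_binary_truncation {C : ℝ} (hC : 1 ≤ C) (m : ℕ) :
    ∃ M : ℝ, 0 ≤ M ∧ ∀ (n : ℕ) (N : (Fin n → ℝ) → ℝ),
      IsQuasiNormWith n C N → IsUnconditional n N →
      ∀ a t : Fin n → ℝ, (∀ i, |t i| ≤ 1) → ∃ s r : Fin n → ℝ,
        t = s + (1 / 2 : ℝ) ^ m • r ∧ (∀ i, |r i| ≤ 1) ∧ N (s * a) ≤ M * N a := by
  induction m with
  | zero =>
    refine ⟨0, le_rfl, fun n N hN _ a t ht => ⟨0, t, by simp, ht, ?_⟩⟩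
    simp [(hN.2.1 0).2 rfl]
  | succ m ih =>
    obtain ⟨M, hM, H⟩ := ih
    refine ⟨C * (1 + M), by positivity, fun n N hN hU a t ht => ?_⟩
    let ε : Fin n → ℝ := fun i => if 0 ≤ t i then 1 else -1
    have hε : ∀ i, ε i = 1 ∨ ε i = -1 := fun i => by
      by_cases h : 0 ≤ t i <;> simp [ε, h]
    obtain ⟨s, r, hsr, hr, hs⟩ := H n N hN hU a ((2 : ℝ) • t - ε) fun i => by
      have := abs_le.1 (ht i)
      by_cases h : 0 ≤ t i <;> simp only [ε, h, Pi.sub_apply, Pi.smul_apply, smul_eq_mul,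
        if_true, if_false] <;> rw [abs_le] <;> constructor <;> linarith
    refine ⟨(1 / 2 : ℝ) • (ε + s), r, ?_, hr, ?_⟩
    · ext i
      have := congrFun hsr i
      simp only [Pi.sub_apply, Pi.add_apply, Pi.smul_apply, smul_eq_mul] at this ⊢
      rw [pow_succ]
      linarith
    · have hεa : N (ε * a) = N a := hU a ε hε
      have htri := hN.2.2.2 (ε * a) (s * a)
      rw [hεa] at htri
      rw [smul_mul_assoc, hN.2.2.1, add_mul, abs_of_pos (by norm_num : (0 : ℝ) < 1 / 2)]
      have h0 := hN.1 (ε * a + s * a)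
      have h1 : C * (N a + N (s * a)) ≤ C * (N a + M * N a) := by gcongr
      linarith

/-- Lattice property of unconditional quasi-norms: for every `C₀ ≥ 1` there is `K ≥ 1`
depending only on `C₀` such that for every `1`-unconditional quasi-norm on `ℝ^n` with
quasi-norm constant at most `C₀` and all vectors `a, b` with `|b i| ≤ |a i|` for all `i`,
one has `‖b‖ ≤ K ‖a‖`. -/
theorem unconditional_lattice_bound :
    ∀ C₀ : ℝ, 1 ≤ C₀ → ∃ K : ℝ, 1 ≤ K ∧
      ∀ (n : ℕ) (N : (Fin n → ℝ) → ℝ),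
        IsQuasiNormWith n C₀ N → IsUnconditional n N →
        ∀ a b : Fin n → ℝ, (∀ i, |b i| ≤ |a i|) → N b ≤ K * N a := by
  intro C hC
  have hC0 : 0 < C := by linarith
  obtain ⟨m, hm⟩ := exists_pow_lt_of_lt_one (show 0 < 1 / (2 * C) by positivity)
    (by norm_num : (1 / 2 : ℝ) < 1)
  have hm' : C * (1 / 2 : ℝ) ^ m ≤ 1 / 2 := by
    calc C * (1 / 2 : ℝ) ^ m ≤ C * (1 / (2 * C)) := by gcongr
      _ = 1 / 2 := by field_simp
  obtain ⟨M, hM, H⟩ := exists_binary_truncation hC m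
  refine ⟨1 + 2 * (C * M), by nlinarith [mul_nonneg hC0.le hM], fun n N hN hU a b hab => ?_⟩
  let S : Set ℝ := {y | ∃ t : Fin n → ℝ, (∀ i, |t i| ≤ 1) ∧ N (t * a) = y}
  have hbdd : BddAbove S := by
    obtain ⟨B, hB⟩ := hN.exists_bound_of_abs_le hC a
    refine ⟨B, ?_⟩
    rintro _ ⟨t, ht, rfl⟩
    refine hB _ fun i => ?_
    rw [Pi.mul_apply, abs_mul]
    exact mul_le_of_le_one_left (abs_nonneg _) (ht i)
  have hne : S.Nonempty := ⟨_, 0, by simp, rfl⟩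
  have hsup0 : 0 ≤ sSup S := Real.sSup_nonneg (by rintro _ ⟨t, -, rfl⟩; exact hN.1 _)
  have hself : sSup S ≤ C * (M * N a) + 1 / 2 * sSup S := by
    refine csSup_le hne ?_
    rintro _ ⟨t, ht, rfl⟩
    obtain ⟨s, r, rfl, hr, hs⟩ := H n N hN hU a t ht
    have hrS : N (r * a) ≤ sSup S := le_csSup hbdd ⟨r, hr, rfl⟩
    rw [add_mul, smul_mul_assoc]
    calc N (s * a + (1 / 2 : ℝ) ^ m • (r * a))
        ≤ C * (N (s * a) + N ((1 / 2 : ℝ) ^ m • (r * a))) := hN.2.2.2 _ _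
      _ = C * N (s * a) + C * (1 / 2 : ℝ) ^ m * N (r * a) := by
        rw [hN.2.2.1, abs_of_pos (by positivity : (0 : ℝ) < (1 / 2) ^ m)]
        ring
      _ ≤ C * (M * N a) + 1 / 2 * sSup S :=
        add_le_add (mul_le_mul_of_nonneg_left hs hC0.le)
          (mul_le_mul hm' hrS (hN.1 _) (by norm_num))
  have hb : N b ≤ sSup S := by
    refine le_csSup hbdd ⟨b / a, fun i => ?_, congrArg N ?_⟩
    · rw [Pi.div_apply, abs_div]
      exact div_le_one_of_le₀ (hab i) (abs_nonneg _)
    · ext i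
      rcases eq_or_ne (a i) 0 with h | h
      · have : b i = 0 := by simpa [h] using hab i
        simp [h, this]
      · simp [h]
  have ha := hN.1 a
  linarith
end

section
/- For every constant C₀ ≥ 1 there exists a constant K ≥ 1 depending only on C₀ such that the following holds: for every n ∈ ℕ and every 1-symmetric quasi-norm ‖·‖_X on ℝ^n with quasi-norm constant at most C₀, the operator norm of the identity from ℓ_∞^n to X = (ℝ^n, ‖·‖_X) satisfies φ_X(n) ≤ ‖id: ℓ_∞^n → X‖ ≤ K · φ_X(n), where φ_X(n) = ‖(1, …, 1)‖_X and ‖id: ℓ_∞^n → X‖ = sup{‖x‖_X : max_i |x_i| ≤ 1}. -/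
/-- The sup norm `max_i |x i|` on `ℝ^n` (as a supremum, which is `0` for `n = 0`). -/
noncomputable def supNorm (n : ℕ) (x : Fin n → ℝ) : ℝ :=
  sSup {t : ℝ | ∃ i : Fin n, t = |x i|}

theorem supNorm_le_one_iff {n : ℕ} {x : Fin n → ℝ} : supNorm n x ≤ 1 ↔ ∀ i, |x i| ≤ 1 := by
  constructor
  · intro h i
    have hfin : {t : ℝ | ∃ i : Fin n, t = |x i|}.Finite :=
      (Set.finite_range fun i => |x i|).subset (by rintro _ ⟨i, rfl⟩; exact ⟨i, rfl⟩)
    exact (le_csSup hfin.bddAbove ⟨i, rfl⟩).trans h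
  · intro h
    refine Real.sSup_le ?_ zero_le_one
    rintro _ ⟨i, rfl⟩
    exact h i

theorem IsSymmetricNorm.isUnconditional {n : ℕ} {N : (Fin n → ℝ) → ℝ}
    (h : IsSymmetricNorm n N) : IsUnconditional n N :=
  fun x ε hε => h x ε 1 hε

/-- A quasi-norm on `ℝ^n` is bounded on the unit cube. -/
theorem IsQuasiNormWith.exists_bound_cube {n : ℕ} {C : ℝ} {N : (Fin n → ℝ) → ℝ} (hC : 0 ≤ C)
    (hN : IsQuasiNormWith n C N) : ∃ M, ∀ x : Fin n → ℝ, (∀ i, |x i| ≤ 1) → N x ≤ M := by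
  obtain ⟨hnonneg, hzero, hsmul, hadd⟩ := hN
  have key : ∀ s : Finset (Fin n), ∃ M, ∀ x : Fin n → ℝ, (∀ i, |x i| ≤ 1) →
      N (∑ i ∈ s, x i • Pi.single i (1 : ℝ)) ≤ M := by
    intro s
    induction s using Finset.induction_on with
    | empty => exact ⟨0, fun x _ => by simp [(hzero 0).2 rfl]⟩
    | insert a s ha ih =>
      obtain ⟨M, hM⟩ := ih
      refine ⟨C * (N (Pi.single a 1) + M), fun x hx => ?_⟩
      rw [Finset.sum_insert ha]
      refine (hadd _ _).trans (mul_le_mul_of_nonneg_left (add_le_add ?_ (hM x hx)) hC)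
      rw [hsmul]
      exact mul_le_of_le_one_left (hnonneg _) (hx a)
  obtain ⟨M, hM⟩ := key Finset.univ
  refine ⟨M, fun x hx => ?_⟩
  rw [pi_eq_sum_univ' x]
  exact hM x hx

/-- A point of the cube is half a sign vector plus half a point of the cube. -/
theorem exists_sign_add_cube {n : ℕ} {y : Fin n → ℝ} (hy : ∀ i, |y i| ≤ 1) :
    ∃ ε z : Fin n → ℝ, (∀ i, ε i = 1 ∨ ε i = -1) ∧ (∀ i, |z i| ≤ 1) ∧
      y = (2⁻¹ : ℝ) • (ε + z) := by
  have h : ∀ i, ∃ e z : ℝ, (e = 1 ∨ e = -1) ∧ |z| ≤ 1 ∧ y i = 2⁻¹ * (e + z) := by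
    intro i
    have hi := abs_le.1 (hy i)
    rcases le_total 0 (y i) with h0 | h0
    · exact ⟨1, 2 * y i - 1, Or.inl rfl, abs_le.2 ⟨by linarith, by linarith⟩, by ring⟩
    · exact ⟨-1, 2 * y i + 1, Or.inr rfl, abs_le.2 ⟨by linarith, by linarith⟩, by ring⟩
  choose ε z hε hz hy using h
  exact ⟨ε, z, hε, hz, funext hy⟩

/-- Truncated binary expansion of a point of the cube: the number `A` controlling the truncation
depends only on `C` and on the length `m` of the expansion. -/
theorem exists_binary_expansion_bound {C : ℝ} (hC : 0 ≤ C) (m : ℕ) : ∃ A : ℝ, 0 ≤ A ∧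
    ∀ (n : ℕ) (N : (Fin n → ℝ) → ℝ), IsQuasiNormWith n C N → IsUnconditional n N →
      ∀ x : Fin n → ℝ, (∀ i, |x i| ≤ 1) → ∃ s y : Fin n → ℝ,
        x = s + ((2⁻¹ : ℝ) ^ m) • y ∧ (∀ i, |y i| ≤ 1) ∧ N s ≤ A * N (fun _ => 1) := by
  induction m with
  | zero =>
    exact ⟨0, le_rfl, fun n N hN _ x hx => ⟨0, x, by simp, hx, by simp [(hN.2.1 0).2 rfl]⟩⟩
  | succ m ih =>
    obtain ⟨A, hA, h⟩ := ih
    refine ⟨C * (A + 1), by positivity, fun n N hN hU x hx => ?_⟩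
    obtain ⟨s, y, rfl, hy, hs⟩ := h n N hN hU x hx
    obtain ⟨ε, z, hε, hz, rfl⟩ := exists_sign_add_cube hy
    refine ⟨s + ((2⁻¹ : ℝ) ^ (m + 1)) • ε, z, ?_, hz, ?_⟩
    · rw [pow_succ, smul_smul, smul_add, add_assoc]
    · have hNε : N ε = N (fun _ => 1) := by simpa using hU (fun _ => 1) ε hε
      have hle : |(2⁻¹ : ℝ) ^ (m + 1)| ≤ 1 := by
        rw [abs_of_nonneg (by positivity)]
        exact pow_le_one₀ (by norm_num) (by norm_num)
      calc N (s + ((2⁻¹ : ℝ) ^ (m + 1)) • ε)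
          ≤ C * (N s + N (((2⁻¹ : ℝ) ^ (m + 1)) • ε)) := hN.2.2.2 _ _
        _ ≤ C * (A * N (fun _ => 1) + N (fun _ => 1)) := by
          refine mul_le_mul_of_nonneg_left (add_le_add hs ?_) hC
          rw [hN.2.2.1, hNε]
          exact mul_le_of_le_one_left (hN.1 _) hle
        _ = C * (A + 1) * N (fun _ => 1) := by ring

/-- For every `C₀ ≥ 1` there is `K ≥ 1` depending only on `C₀` such that for every
`1`-symmetric quasi-norm `‖·‖_X` on `ℝ^n` with quasi-norm constant at most `C₀`,
`φ_X(n) ≤ ‖id : ℓ_∞^n → X‖ ≤ K φ_X(n)`, where `φ_X(n) = ‖(1,…,1)‖_X`. -/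
theorem opNorm_linfty_to_symmetric :
    ∀ C₀ : ℝ, 1 ≤ C₀ → ∃ K : ℝ, 1 ≤ K ∧
      ∀ (n : ℕ), 0 < n → ∀ N : (Fin n → ℝ) → ℝ,
        IsQuasiNormWith n C₀ N → IsSymmetricNorm n N →
        N (fun _ => 1) ≤ opNorm n (supNorm n) N ∧
          opNorm n (supNorm n) N ≤ K * N (fun _ => 1) := by
  intro C hC
  have hC0 : 0 ≤ C := zero_le_one.trans hC
  obtain ⟨m, hm⟩ := exists_pow_lt_of_lt_one (show (0 : ℝ) < (2 * C)⁻¹ by positivity)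
    (show (2⁻¹ : ℝ) < 1 by norm_num)
  have hCm : C * (2⁻¹ : ℝ) ^ m ≤ 2⁻¹ := by
    calc C * (2⁻¹ : ℝ) ^ m ≤ C * (2 * C)⁻¹ := mul_le_mul_of_nonneg_left hm.le hC0
      _ = 2⁻¹ := by field_simp
  obtain ⟨A, hA, hexp⟩ := exists_binary_expansion_bound hC0 m
  refine ⟨2 * C * A + 1, le_add_of_nonneg_left (by positivity), fun n _ N hN hS => ?_⟩
  obtain ⟨M, hM⟩ := hN.exists_bound_cube hC0
  have hone : supNorm n (fun _ => 1) ≤ 1 := supNorm_le_one_iff.2 fun _ => by simp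
  have hbdd : BddAbove {t : ℝ | ∃ x : Fin n → ℝ, supNorm n x ≤ 1 ∧ t = N x} := by
    refine ⟨M, ?_⟩
    rintro _ ⟨x, hx, rfl⟩
    exact hM x (supNorm_le_one_iff.1 hx)
  refine ⟨le_csSup hbdd ⟨_, hone, rfl⟩, ?_⟩
  have hself : opNorm n (supNorm n) N ≤
      C * (A * N (fun _ => 1)) + 2⁻¹ * opNorm n (supNorm n) N := by
    refine csSup_le ⟨_, _, hone, rfl⟩ ?_
    rintro _ ⟨x, hx, rfl⟩
    obtain ⟨s, y, rfl, hy, hs⟩ := hexp n N hN hS.isUnconditional x (supNorm_le_one_iff.1 hx)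
    have hNy : N y ≤ opNorm n (supNorm n) N := le_csSup hbdd ⟨y, supNorm_le_one_iff.2 hy, rfl⟩
    calc N (s + ((2⁻¹ : ℝ) ^ m) • y)
        ≤ C * (N s + N (((2⁻¹ : ℝ) ^ m) • y)) := hN.2.2.2 _ _
      _ = C * N s + C * (2⁻¹ : ℝ) ^ m * N y := by
        rw [hN.2.2.1, abs_of_nonneg (by positivity)]
        ring
      _ ≤ C * (A * N (fun _ => 1)) + 2⁻¹ * opNorm n (supNorm n) N :=
        add_le_add (mul_le_mul_of_nonneg_left hs hC0)
          (mul_le_mul hCm hNy (hN.1 _) (by norm_num))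
  linarith [hN.1 (fun _ => 1)]
end
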